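/- arXiv:2402.05638 — 3 statements merged into one kernel-verified Lean document; each statement's English description precedes it below -/
import Mathlib

section
/- The set of locally eventually onto maps is residual in (cl(CP), ρ), but it is not an open subset of cl(CP). -/
open Set Function Metric

/-- The unit interval `[0,1]` with the Euclidean metric. -/
abbrev unitI : Type := Set.Icc (0:ℝ) 1

/-- `CP`: continuous surjective self-maps of `I` with a dense set of periodic points.
The ambient space `C(I,I)` carries the uniform (sup) metric. -/
def CP : Set C(unitI, unitI) :=
  {f | Function.Surjective ⇑f ∧ Dense (Function.periodicPts ⇑f)}

/-- `f` is locally eventually onto (leo, topologically exact): every nonempty open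
subset of `I` is mapped onto `I` by some iterate of `f`. -/
def Leo (f : unitI → unitI) : Prop :=
  ∀ U : Set unitI, IsOpen U → U.Nonempty → ∃ n : ℕ, f^[n] '' U = Set.univ

open Relation

/-- The triangle wave: the distance of a real number to the nearest integer. -/
noncomputable def triWave (y : ℝ) : ℝ := ‖(y : UnitAddCircle)‖

lemma continuous_triWave : Continuous triWave :=
  continuous_norm.comp (AddCircle.continuous_mk' 1)

lemma triWave_nonneg (y : ℝ) : 0 ≤ triWave y := norm_nonneg _

lemma triWave_le_half (y : ℝ) : triWave y ≤ 1 / 2 := by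
  unfold triWave
  rw [UnitAddCircle.norm_eq]
  exact abs_sub_round y

lemma triWave_eq_abs {y : ℝ} (k : ℤ) (h : |y - k| ≤ 1 / 2) : triWave y = |y - k| := by
  unfold triWave
  rw [UnitAddCircle.norm_eq]
  refine le_antisymm (round_le y k) ?_
  rcases eq_or_ne (round y) k with hk | hk
  · rw [hk]
  · have h1 : (1 : ℝ) ≤ |(k : ℝ) - round y| := by
      exact_mod_cast Int.one_le_abs (sub_ne_zero.mpr hk.symm)
    have h2 := abs_sub_le (k : ℝ) y (round y)
    rw [abs_sub_comm (k : ℝ) y] at h2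
    linarith

lemma triWave_int (k : ℤ) : triWave k = 0 := by
  rw [triWave_eq_abs k] <;> simp

lemma triWave_int_add_half (k : ℤ) : triWave (k + 1 / 2) = 1 / 2 := by
  rw [triWave_eq_abs k] <;> simp

lemma triWave_nat_add_quarter (k : ℕ) : triWave (k + 1 / 4) = 1 / 4 := by
  rw [triWave_eq_abs k] <;> norm_num [abs_of_pos]

lemma abs_triWave_sub_le (x y : ℝ) : |triWave x - triWave y| ≤ |x - y| := by
  refine (abs_norm_sub_norm_le _ _).trans ?_
  rw [← AddCircle.coe_sub, UnitAddCircle.norm_eq]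
  simpa using round_le (x - y) 0

/-- Every interval of unit length contains a minimum and a maximum of the triangle wave. -/
lemma exists_triWave_extrema (u : ℝ) :
    (∃ p ∈ Icc u (u + 1), triWave p = 0) ∧ ∃ q ∈ Icc u (u + 1), triWave q = 1 / 2 := by
  refine ⟨⟨⌈u⌉, ⟨Int.le_ceil u, (Int.ceil_lt_add_one u).le⟩, triWave_int _⟩,
    ⟨⌈u - 1 / 2⌉ + 1 / 2, ⟨?_, ?_⟩, triWave_int_add_half _⟩⟩
  · linarith [Int.le_ceil (u - 1 / 2)]
  · linarith [Int.ceil_lt_add_one (u - 1 / 2)]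

/-- On one half of a short interval the triangle wave is an isometry. -/
lemma triWave_half_isometry {u v : ℝ} (huv : u ≤ v) (h : v - u ≤ 1 / 2) :
    |triWave u - triWave ((u + v) / 2)| = (v - u) / 2 ∨
      |triWave ((u + v) / 2) - triWave v| = (v - u) / 2 := by
  have hlap : ∀ (k : ℤ) (x y : ℝ), x ≤ y → ((k : ℝ) ≤ x ∧ y ≤ k + 1 / 2 ∨
      (k : ℝ) - 1 / 2 ≤ x ∧ y ≤ k) → |triWave x - triWave y| = y - x := by
    rintro k x y hxy (⟨h1, h2⟩ | ⟨h1, h2⟩)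
    · rw [triWave_eq_abs k, triWave_eq_abs (y := y) k, abs_of_nonneg (a := x - k),
        abs_of_nonneg (a := y - k), abs_of_nonpos] <;>
        first | linarith | (rw [abs_le]; constructor <;> linarith)
    · rw [triWave_eq_abs k, triWave_eq_abs (y := y) k, abs_of_nonpos (a := x - k),
        abs_of_nonpos (a := y - k), abs_of_nonneg] <;>
        first | linarith | (rw [abs_le]; constructor <;> linarith)
  have hu1 := Int.floor_le u
  have hu2 := Int.lt_floor_add_one u
  set k := ⌊u⌋
  rcases le_total u (k + 1 / 2) with hu | hu
  · rcases le_total ((u + v) / 2) (k + 1 / 2) with hm | hm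
    · left; rw [hlap k _ _ (by linarith) (Or.inl ⟨hu1, hm⟩)]; ring
    · right
      rw [hlap (k + 1) _ _ (by linarith) (Or.inr ⟨by push_cast; linarith, by push_cast; linarith⟩)]
      ring
  · rcases le_total ((u + v) / 2) (k + 1) with hm | hm
    · left
      rw [hlap (k + 1) _ _ (by linarith) (Or.inr ⟨by push_cast; linarith, by push_cast; linarith⟩)]
      ring
    · right
      rw [hlap (k + 1) _ _ (by linarith) (Or.inl ⟨by push_cast; linarith, by push_cast; linarith⟩)]
      ring

/-- The folding of `[-1, 2]` onto `[0, 1]` by reflections in the endpoints of `[0, 1]`. -/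
noncomputable def foldI (y : ℝ) : ℝ := |(1 - |1 - y|)|

lemma continuous_foldI : Continuous foldI := by
  unfold foldI; fun_prop

lemma foldI_eq_self {y : ℝ} (hy : y ∈ Icc (0 : ℝ) 1) : foldI y = y := by
  unfold foldI
  rw [abs_of_nonneg (a := 1 - y) (by linarith [hy.2]), sub_sub_cancel, abs_of_nonneg hy.1]

lemma foldI_mem {y : ℝ} (hy : y ∈ Icc (-1 : ℝ) 2) : foldI y ∈ Icc (0 : ℝ) 1 := by
  refine ⟨abs_nonneg _, ?_⟩
  unfold foldI
  have h : |1 - y| ≤ 2 := abs_le.mpr ⟨by linarith [hy.2], by linarith [hy.1]⟩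
  exact abs_le.mpr ⟨by linarith, by linarith [abs_nonneg (1 - y)]⟩

lemma abs_foldI_sub_le {y w : ℝ} (hw : w ∈ Icc (0 : ℝ) 1) : |foldI y - w| ≤ |y - w| := by
  nth_rw 1 [← foldI_eq_self hw]
  unfold foldI
  refine (abs_abs_sub_abs_le _ _).trans ?_
  rw [sub_sub_sub_cancel_left]
  refine (abs_abs_sub_abs_le _ _).trans ?_
  rw [sub_sub_sub_cancel_left]

/-- On one half of an interval of length at most one the folding map is an isometry. -/
lemma foldI_half_isometry {p r : ℝ} (hpr : p ≤ r) (h : r - p ≤ 1) (hp : -1 ≤ p) (hr : r ≤ 2) :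
    |foldI p - foldI ((p + r) / 2)| = (r - p) / 2 ∨
      |foldI ((p + r) / 2) - foldI r| = (r - p) / 2 := by
  have neg : ∀ y : ℝ, -1 ≤ y → y ≤ 0 → foldI y = -y := fun y _ h2 ↦ by
    unfold foldI
    rw [abs_of_nonneg (a := 1 - y) (by linarith), sub_sub_cancel, abs_of_nonpos h2]
  have big : ∀ y : ℝ, 1 ≤ y → y ≤ 2 → foldI y = 2 - y := fun y h1 h2 ↦ by
    unfold foldI
    rw [abs_of_nonpos (a := 1 - y) (by linarith), abs_of_nonneg (by linarith)]
    ring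
  have hlap : ∀ x y : ℝ, x ≤ y → (-1 ≤ x ∧ y ≤ 0 ∨ 0 ≤ x ∧ y ≤ 1 ∨ 1 ≤ x ∧ y ≤ 2) →
      |foldI x - foldI y| = y - x := by
    rintro x y hxy (⟨h1, h2⟩ | ⟨h1, h2⟩ | ⟨h1, h2⟩)
    · rw [neg x h1 (by linarith), neg y (by linarith) h2, abs_of_nonneg] <;> linarith
    · rw [foldI_eq_self ⟨h1, by linarith⟩, foldI_eq_self ⟨by linarith, h2⟩, abs_of_nonpos] <;>
        linarith
    · rw [big x h1 (by linarith), big y (by linarith) h2, abs_of_nonneg] <;> linarith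
  have left (h : |foldI p - foldI ((p + r) / 2)| = (p + r) / 2 - p) :
      |foldI p - foldI ((p + r) / 2)| = (r - p) / 2 := by rw [h]; ring
  have right (h : |foldI ((p + r) / 2) - foldI r| = r - (p + r) / 2) :
      |foldI ((p + r) / 2) - foldI r| = (r - p) / 2 := by rw [h]; ring
  have e1 := hlap p ((p + r) / 2) (by linarith)
  have e2 := hlap ((p + r) / 2) r (by linarith)
  rcases le_total ((p + r) / 2) 0 with hm | hm
  · exact Or.inl (left (e1 (Or.inl ⟨hp, hm⟩)))
  rcases le_total 1 ((p + r) / 2) with hm' | hm'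
  · exact Or.inr (right (e2 (Or.inr (Or.inr ⟨hm', hr⟩))))
  rcases le_total 0 p with h0 | h0
  · exact Or.inl (left (e1 (Or.inr (Or.inl ⟨h0, hm'⟩))))
  · exact Or.inr (right (e2 (Or.inr (Or.inl ⟨hm, by linarith⟩))))

lemma Leo.surjective {f : unitI → unitI} (hf : Leo f) : Surjective f := by
  obtain ⟨n, hn⟩ := hf (Iio 1) isOpen_Iio ⟨0, by simp⟩
  cases n with
  | zero =>
    have : (1 : unitI) ∈ f^[0] '' Iio 1 := hn ▸ mem_univ _
    simp at this
  | succ n =>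
    intro y
    obtain ⟨x, -, rfl⟩ : y ∈ f^[n + 1] '' Iio 1 := hn ▸ mem_univ _
    exact ⟨f^[n] x, (iterate_succ_apply' f n x).symm⟩

lemma exists_Icc_subset_of_isOpen {U : Set unitI} (hU : IsOpen U) (hne : U.Nonempty) :
    ∃ a b, a < b ∧ Icc a b ⊆ U := by
  obtain ⟨a, b, hab, h⟩ := hU.exists_Ioo_subset hne
  obtain ⟨c, hac, hcb⟩ := exists_between hab
  obtain ⟨d, hcd, hdb⟩ := exists_between hcb
  exact ⟨c, d, hcd, fun x hx ↦ h ⟨hac.trans_le hx.1, hx.2.trans_lt hdb⟩⟩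

lemma Leo.mem_CP {f : C(unitI, unitI)} (hf : Leo f) : f ∈ CP := by
  refine ⟨hf.surjective, dense_iff_inter_open.mpr fun U hU hne ↦ ?_⟩
  obtain ⟨a, b, hab, hsub⟩ := exists_Icc_subset_of_isOpen hU hne
  obtain ⟨n, hn⟩ := hf (Ioo a b) isOpen_Ioo (nonempty_Ioo.mpr hab)
  obtain ⟨u, hu, hua⟩ : a ∈ (⇑f)^[n] '' Ioo a b := hn ▸ mem_univ _
  obtain ⟨v, hv, hvb⟩ : b ∈ (⇑f)^[n] '' Ioo a b := hn ▸ mem_univ _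
  obtain ⟨x, hx, hfix⟩ := (isPreconnected_Ioo (a := a) (b := b)).intermediate_value₂ hu hv
    (f.continuous.iterate n).continuousOn continuousOn_id
    (by rw [hua]; exact hu.1.le) (by rw [hvb]; exact hv.2.le)
  refine ⟨x, hsub (Ioo_subset_Icc_self hx), mk_mem_periodicPts (n := n) ?_ hfix⟩
  rcases Nat.eq_zero_or_pos n with rfl | h
  · exact absurd hua hu.1.ne'
  · exact h

/-- A map that doubles the size of small intervals, and some iterate of which maps each large
interval onto the whole space, is locally eventually onto. -/
lemma leo_of_expanding (g : C(unitI, unitI)) {l : ℝ} (hl : l ≤ 1)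
    (hexp : ∀ a b : unitI, a < b → ∃ u ∈ Icc a b, ∃ v ∈ Icc a b,
      min (2 * ((b : ℝ) - a)) l ≤ |(g v : ℝ) - g u|)
    (hlong : ∀ a b : unitI, l ≤ (b : ℝ) - a → ∃ n : ℕ, (⇑g)^[n] '' Icc a b = univ) : Leo g := by
  have key : ∀ (k : ℕ) (a b : unitI), a < b → 1 ≤ 2 ^ k * ((b : ℝ) - a) →
      ∃ n : ℕ, (⇑g)^[n] '' Icc a b = univ := by
    intro k
    induction k with
    | zero => exact fun a b _ h ↦ hlong a b (by linarith)
    | succ k ih =>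
      intro a b hab h
      by_cases hlab : l ≤ (b : ℝ) - a
      · exact hlong a b hlab
      have hab' : (0 : ℝ) < b - a := sub_pos.mpr hab
      obtain ⟨u, hu, v, hv, huv, hdist⟩ : ∃ u ∈ Icc a b, ∃ v ∈ Icc a b,
          (g u < g v) ∧ min (2 * ((b : ℝ) - a)) l ≤ (g v : ℝ) - g u := by
        obtain ⟨u, hu, v, hv, h⟩ := hexp a b hab
        have hpos : 0 < |(g v : ℝ) - g u| := lt_of_lt_of_le (lt_min (by linarith) (by linarith)) h
        rcases lt_trichotomy (g u) (g v) with h1 | h1 | h1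
        · exact ⟨u, hu, v, hv, h1, by rwa [abs_of_pos ((sub_pos (α := ℝ)).mpr h1)] at h⟩
        · simp [h1] at hpos
        · exact ⟨v, hv, u, hu, h1, by rwa [abs_sub_comm, abs_of_pos ((sub_pos (α := ℝ)).mpr h1)] at h⟩
      have hsub : Icc (g u) (g v) ⊆ g '' Icc a b :=
        (isPreconnected_Icc.image g g.continuous.continuousOn).Icc_subset
          (mem_image_of_mem g hu) (mem_image_of_mem g hv)
      obtain ⟨n, hn⟩ : ∃ n : ℕ, (⇑g)^[n] '' Icc (g u) (g v) = univ := by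
        rcases min_le_iff.mp hdist with h1 | h1
        · refine ih _ _ huv (h.trans ?_)
          rw [pow_succ, mul_assoc]
          gcongr
        · exact hlong _ _ h1
      refine ⟨n + 1, univ_subset_iff.mp ?_⟩
      rw [iterate_succ, image_comp, ← hn]
      exact image_mono hsub
  intro U hU hne
  obtain ⟨a, b, hab, hsub⟩ := exists_Icc_subset_of_isOpen hU hne
  have hab' : (0 : ℝ) < b - a := sub_pos.mpr hab
  obtain ⟨k, hk⟩ := pow_unbounded_of_one_lt (1 / ((b : ℝ) - a)) one_lt_two
  obtain ⟨n, hn⟩ := key k a b hab ((div_le_iff₀ hab').mp hk.le)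
  exact ⟨n, univ_subset_iff.mp (hn ▸ image_mono hsub)⟩

/-- If the periodic points are dense, any two points are joined by a pseudo-orbit. -/
lemma reflTransGen_of_dense_periodicPts {f : C(unitI, unitI)} (hf : Dense (periodicPts ⇑f))
    {η : ℝ} (hη : 0 < η) (x y : unitI) :
    ReflTransGen (fun x z ↦ dist z (f x) ≤ η) x y := by
  set step : unitI → unitI → Prop := fun x z ↦ dist z (f x) ≤ η with hstep
  have orbit : ∀ (p : unitI) (i : ℕ), ReflTransGen step p ((⇑f)^[i] p) := by
    intro p i
    induction i with
    | zero => exact .refl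
    | succ i ih =>
      refine ih.tail ?_
      simp only [hstep, iterate_succ_apply', dist_self]
      exact hη.le
  obtain ⟨δ, hδ, hf'⟩ := Metric.uniformContinuous_iff.mp
    (CompactSpace.uniformContinuous_of_continuous f.continuous) η hη
  set r := min δ η / 2 with hr
  have hmin : 0 < min δ η := lt_min hδ hη
  have hrpos : 0 < r := by positivity
  have hrδ : r < δ := by linarith [min_le_left δ η]
  have hrη : r + r ≤ η := by linarith [min_le_right δ η]
  set S := {y | ReflTransGen step x y} with hS
  have hball : ∀ y ∈ S, ball y r ⊆ S := by
    intro y hy z hz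
    obtain ⟨p, hp, hpy⟩ := Metric.dense_iff.mp hf y r hrpos
    obtain ⟨k, hk, hper⟩ := hpy
    have h1 : step y (f p) := (hf' ((mem_ball.mp hp).trans hrδ)).le
    have h2 := orbit (f p) (2 * k - 2)
    have h3 : f ((⇑f)^[2 * k - 2] (f p)) = p := by
      rw [← iterate_succ_apply, ← iterate_succ_apply' (⇑f),
        show (2 * k - 2).succ.succ = k * 2 by have : 0 < k := hk; omega]
      exact hper.mul_const 2
    have h4 : step ((⇑f)^[2 * k - 2] (f p)) z := by
      simp only [hstep, h3]
      have := dist_triangle_right z p y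
      have := mem_ball.mp hz
      have := mem_ball.mp hp
      linarith
    exact ((ReflTransGen.tail hy h1).trans h2).tail h4
  have hopen : IsOpen S := Metric.isOpen_iff.mpr fun y hy ↦ ⟨r, hrpos, hball y hy⟩
  have hclosed : IsClosed S := by
    refine ⟨Metric.isOpen_iff.mpr fun y hy ↦ ⟨r, hrpos, fun z hz hzS ↦ hy ?_⟩⟩
    exact hball z hzS (mem_ball_comm.mp hz)
  rcases isClopen_iff.mp ⟨hclosed, hopen⟩ with h | h
  · exact absurd (show x ∈ S from .refl) (h ▸ notMem_empty x)
  · exact (h ▸ mem_univ y : y ∈ S)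

lemma exists_isFixedPt (f : C(unitI, unitI)) : ∃ c, f c = c := by
  obtain ⟨c, -, hc⟩ := (isPreconnected_univ (α := unitI)).intermediate_value₂ (mem_univ 1)
    (mem_univ 0) f.continuous.continuousOn continuousOn_id unitInterval.le_one' unitInterval.nonneg'
  exact ⟨c, hc⟩

/-- If the image under `g` of each long interval contains a neighbourhood of its image under `f`,
then every long interval is eventually mapped onto the whole space by `g`. -/
lemma exists_iterate_image_eq_univ {f g : C(unitI, unitI)} (hf : Dense (periodicPts ⇑f))
    {l η : ℝ} (hη : 0 < η) (hη' : η ≤ 1 / 2) (hl : l ≤ η)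
    (hcov : ∀ a b : unitI, l ≤ (b : ℝ) - a → ∀ x ∈ Icc a b, ∀ z, dist z (f x) ≤ η →
      z ∈ g '' Icc a b) (a b : unitI) (hab : l ≤ (b : ℝ) - a) (hle : a ≤ b) :
    ∃ n : ℕ, (⇑g)^[n] '' Icc a b = univ := by
  set Long : Set unitI → Prop := fun A ↦ IsPreconnected A ∧ ∃ a ∈ A, ∃ b ∈ A, l ≤ (b : ℝ) - a
    with hLong
  have cover : ∀ A, Long A → ∀ x ∈ A, ∀ z, dist z (f x) ≤ η → z ∈ g '' A := by
    rintro A ⟨hA, a, ha, b, hb, hab⟩ x hx z hz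
    have h1 : min a x ∈ A := by rcases min_choice a x with h | h <;> rwa [h]
    have h2 : max b x ∈ A := by rcases max_choice b x with h | h <;> rwa [h]
    refine image_mono (hA.Icc_subset h1 h2) (hcov _ _ ?_ x ⟨min_le_right _ _, le_max_right _ _⟩ z hz)
    have h3 : ((min a x : unitI) : ℝ) ≤ a := min_le_left a x
    have h4 : (b : ℝ) ≤ (max b x : unitI) := le_max_left b x
    linarith
  have long_image : ∀ A, Long A → Long (g '' A) := by
    intro A hA
    have hA' := hA
    obtain ⟨hA1, a, ha, -⟩ := hA'
    refine ⟨hA1.image g g.continuous.continuousOn, ?_⟩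
    have h0 : f a ∈ g '' A := cover A hA a ha _ (by simpa using hη.le)
    have hfa := (f a).2
    rcases le_total (f a : ℝ) (1 / 2) with h | h
    · refine ⟨f a, h0, ⟨f a + η, by linarith [hfa.1], by linarith⟩,
        cover A hA a ha _ ?_, by simpa using hl⟩
      simp [Subtype.dist_eq, abs_of_pos hη]
    · refine ⟨⟨f a - η, by linarith, by linarith [hfa.2]⟩, cover A hA a ha _ ?_, f a, h0,
        by simpa using hl⟩
      simp [Subtype.dist_eq, abs_of_pos hη]
  have long_iterate : ∀ (n : ℕ) A, Long A → Long ((⇑g)^[n] '' A) := by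
    intro n A hA
    induction n with
    | zero => simpa using hA
    | succ n ih => rw [iterate_succ', image_comp]; exact long_image _ ih
  have reach : ∀ x z, ∃ n : ℕ, ∀ A, Long A → x ∈ A → z ∈ (⇑g)^[n] '' A := by
    intro x z
    induction reflTransGen_of_dense_periodicPts hf hη x z with
    | refl => exact ⟨0, fun A _ hx ↦ by simpa using hx⟩
    | tail _ hyz ih =>
      obtain ⟨n, hn⟩ := ih
      refine ⟨n + 1, fun A hA hx ↦ ?_⟩
      rw [iterate_succ', image_comp]
      exact cover _ (long_iterate n A hA) _ (hn A hA hx) _ hyz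
  obtain ⟨c, hc⟩ := exists_isFixedPt f
  have stay : ∀ (n : ℕ) A, Long A → c ∈ A → c ∈ (⇑g)^[n] '' A := by
    intro n A hA hcA
    induction n with
    | zero => simpa using hcA
    | succ n ih =>
      rw [iterate_succ', image_comp]
      exact cover _ (long_iterate n A hA) c ih c (by simpa [hc] using hη.le)
  obtain ⟨k, hk⟩ := reach a c
  obtain ⟨m₀, h₀⟩ := reach c 0
  obtain ⟨m₁, h₁⟩ := reach c 1
  have hA : Long (Icc a b) := ⟨isPreconnected_Icc, a, left_mem_Icc.mpr hle, b,
    right_mem_Icc.mpr hle, hab⟩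
  have hB := long_iterate k _ hA
  have hcB := hk _ hA (left_mem_Icc.mpr hle)
  refine ⟨m₀ + m₁ + k, univ_subset_iff.mp ?_⟩
  rw [iterate_add, image_comp]
  set B := (⇑g)^[k] '' Icc a b
  have z₀ : (0 : unitI) ∈ (⇑g)^[m₀ + m₁] '' B := by
    rw [iterate_add, image_comp]
    exact h₀ _ (long_iterate _ _ hB) (stay _ _ hB hcB)
  have z₁ : (1 : unitI) ∈ (⇑g)^[m₀ + m₁] '' B := by
    rw [add_comm, iterate_add, image_comp]
    exact h₁ _ (long_iterate _ _ hB) (stay _ _ hB hcB)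
  exact fun x _ ↦ (long_iterate _ _ hB).1.Icc_subset z₀ z₁
    ⟨unitInterval.nonneg', unitInterval.le_one'⟩

/-- The perturbation of `F` by a triangle wave of amplitude `c / 4` and frequency `M`, folded back
into `[0, 1]`. -/
noncomputable def wiggle (F : ℝ → ℝ) (c : ℝ) (M : ℕ) (x : ℝ) : ℝ :=
  foldI (F x + c * (triWave (M * x + 1 / 4) - 1 / 4))

section Wiggle

variable {F : ℝ → ℝ} {c θ L : ℝ} {M : ℕ}

lemma abs_wave_le (hc : 0 ≤ c) (x : ℝ) : |c * (triWave x - 1 / 4)| ≤ c / 4 := by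
  rw [abs_mul, abs_of_nonneg hc]
  have : |triWave x - 1 / 4| ≤ 1 / 4 :=
    abs_le.mpr ⟨by linarith [triWave_nonneg x], by linarith [triWave_le_half x]⟩
  nlinarith

/-- Short intervals are expanded by a perturbation of high frequency. -/
lemma exists_wiggle_expanding (hF : ContinuousOn F (Icc 0 1)) (hF01 : MapsTo F (Icc 0 1) (Icc 0 1))
    (hLip : ∀ x ∈ Icc (0 : ℝ) 1, ∀ y ∈ Icc (0 : ℝ) 1, |F x - F y| ≤ L * |x - y|)
    (hc : 0 ≤ c) (hc1 : c ≤ 1) (hM : 0 < M) (hLM : L ≤ M) (hexp : L + 16 ≤ c * M)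
    {a b : ℝ} (ha : 0 ≤ a) (hab : a < b) (hb : b ≤ 1) :
    ∃ u ∈ Icc a b, ∃ v ∈ Icc a b,
      min (2 * (b - a)) (2 / M) ≤ |wiggle F c M v - wiggle F c M u| := by
  have hM' : (0 : ℝ) < M := Nat.cast_pos.mpr hM
  set h : ℝ → ℝ := fun x ↦ F x + c * (triWave (M * x + 1 / 4) - 1 / 4) with hh
  have hcont : ContinuousOn h (Icc 0 1) := by
    have := continuous_triWave
    exact hF.add (by fun_prop)
  have hrange : ∀ x ∈ Icc (0 : ℝ) 1, h x ∈ Icc (-1 : ℝ) 2 := fun x hx ↦ by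
    have h1 := abs_le.mp (abs_wave_le hc (M * x + 1 / 4))
    have h2 := hF01 hx
    exact ⟨by simp only [hh]; linarith [h2.1], by simp only [hh]; linarith [h2.2]⟩
  set d := min (b - a) (1 / (2 * M)) with hd
  have hdpos : 0 < d := lt_min (by linarith) (by positivity)
  have hdb : d ≤ b - a := min_le_left _ _
  have hdM : M * d ≤ 1 / 2 := by
    calc M * d ≤ M * (1 / (2 * M)) := by gcongr; exact min_le_right _ _
      _ = 1 / 2 := by field_simp
  have hgoal : min (2 * (b - a)) (2 / M) ≤ 4 * d := by
    rw [hd]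
    rcases min_choice (b - a) (1 / (2 * (M : ℝ))) with h1 | h1 <;> rw [h1]
    · exact (min_le_left _ _).trans (by linarith)
    · exact (min_le_right _ _).trans (by field_simp; norm_num)
  -- a pair of points on which the unfolded map expands
  obtain ⟨x, hx, y, hy, hxy, hwave⟩ : ∃ x ∈ Icc a b, ∃ y ∈ Icc a b, y - x = d / 2 ∧
      |triWave (M * x + 1 / 4) - triWave (M * y + 1 / 4)| = M * d / 2 := by
    have hsplit := triWave_half_isometry (u := M * a + 1 / 4) (v := M * (a + d) + 1 / 4)
      (by nlinarith) (by linarith)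
    rw [show (M * a + 1 / 4 + (M * (a + d) + 1 / 4)) / 2 = M * (a + d / 2) + 1 / 4 by ring,
      show (M * (a + d) + 1 / 4 - (M * a + 1 / 4)) / 2 = M * d / 2 by ring] at hsplit
    rcases hsplit with h1 | h1
    · exact ⟨a, ⟨le_rfl, hab.le⟩, a + d / 2, ⟨by linarith, by linarith⟩, by ring, h1⟩
    · exact ⟨a + d / 2, ⟨by linarith, by linarith⟩, a + d, ⟨by linarith, by linarith⟩, by ring, h1⟩
  have hsub : Icc a b ⊆ Icc 0 1 := Icc_subset_Icc ha hb
  have hFxy : |F x - F y| ≤ L * (d / 2) := by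
    have := hLip x (hsub hx) y (hsub hy)
    rwa [abs_sub_comm x y, hxy, abs_of_pos (half_pos hdpos)] at this
  have hsum : h x - h y = (F x - F y) + c * (triWave (M * x + 1 / 4) - triWave (M * y + 1 / 4)) := by
    simp only [hh]; ring
  have hcw : |c * (triWave (M * x + 1 / 4) - triWave (M * y + 1 / 4))| = c * (M * d / 2) := by
    rw [abs_mul, abs_of_nonneg hc, hwave]
  have hlow : 8 * d ≤ |h x - h y| := by
    have h1 := abs_sub_abs_le_abs_sub (c * (triWave (M * x + 1 / 4) - triWave (M * y + 1 / 4)))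
      (-(F x - F y))
    rw [abs_neg, sub_neg_eq_add, add_comm (c * _) (F x - F y), ← hsum, hcw] at h1
    nlinarith
  have hupp : |h x - h y| ≤ 1 := by
    rw [hsum]
    refine (abs_add_le _ _).trans ?_
    rw [hcw]
    nlinarith
  obtain ⟨x, hx, y, hy, hle, hlow, hupp⟩ : ∃ x ∈ Icc a b, ∃ y ∈ Icc a b, h x ≤ h y ∧
      8 * d ≤ h y - h x ∧ h y - h x ≤ 1 := by
    rcases le_total (h x) (h y) with h1 | h1
    · rw [abs_of_nonpos (by linarith), neg_sub] at hlow hupp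
      exact ⟨x, hx, y, hy, h1, hlow, hupp⟩
    · rw [abs_of_nonneg (by linarith)] at hlow hupp
      exact ⟨y, hy, x, hx, h1, hlow, hupp⟩
  obtain ⟨z, hz, hzq⟩ : (h x + h y) / 2 ∈ h '' Icc a b :=
    (isPreconnected_Icc.image h (hcont.mono hsub)).Icc_subset (mem_image_of_mem h hx)
      (mem_image_of_mem h hy) ⟨by linarith, by linarith⟩
  rcases foldI_half_isometry hle hupp (hrange x (hsub hx)).1 (hrange y (hsub hy)).2 with h1 | h1
  · refine ⟨z, hz, x, hx, ?_⟩
    rw [← hzq] at h1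
    exact hgoal.trans (by change _ ≤ |foldI (h x) - foldI (h z)|; linarith)
  · refine ⟨y, hy, z, hz, ?_⟩
    rw [← hzq] at h1
    exact hgoal.trans (by change _ ≤ |foldI (h z) - foldI (h y)|; linarith)

/-- The image of a long interval under a perturbation of high frequency contains a neighbourhood of
its image under the unperturbed map. -/
lemma mem_wiggle_image (hF : ContinuousOn F (Icc 0 1))
    (hLip : ∀ x ∈ Icc (0 : ℝ) 1, ∀ y ∈ Icc (0 : ℝ) 1, |F x - F y| ≤ L * |x - y|)
    (hL : 0 ≤ L) (hM : 0 < M) (hLM : L ≤ θ * M) {a b : ℝ} (ha : 0 ≤ a) (hb : b ≤ 1)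
    (hab : 2 / M ≤ b - a) {x z : ℝ} (hx : x ∈ Icc a b) (hz : z ∈ Icc (0 : ℝ) 1)
    (hzx : |z - F x| ≤ c / 4 - θ) : z ∈ wiggle F c M '' Icc a b := by
  have hM' : (0 : ℝ) < M := Nat.cast_pos.mpr hM
  set h : ℝ → ℝ := fun x ↦ F x + c * (triWave (M * x + 1 / 4) - 1 / 4) with hh
  have hsub : Icc a b ⊆ Icc 0 1 := Icc_subset_Icc ha hb
  have hcont : ContinuousOn h (Icc a b) := by
    have := continuous_triWave
    exact (hF.mono hsub).add (by fun_prop)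
  obtain ⟨w, hwa, hwb, hwx, hxw⟩ : ∃ w, a ≤ w ∧ w + 1 / M ≤ b ∧ w ≤ x ∧ x ≤ w + 1 / M := by
    have h2 : (2 : ℝ) / M = 1 / M + 1 / M := by ring
    have h3 : (0 : ℝ) < 1 / M := by positivity
    rcases le_total (x + 1 / M) b with h1 | h1
    · exact ⟨x, hx.1, h1, le_rfl, by linarith⟩
    · exact ⟨x - 1 / M, by linarith, by linarith [hx.2], by linarith, by linarith⟩
  have pull : ∀ p ∈ Icc (M * w + 1 / 4) (M * w + 1 / 4 + 1),
      ∃ y ∈ Icc a b, M * y + 1 / 4 = p ∧ |F y - F x| ≤ θ := by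
    intro p hp
    have hMy : M * ((p - 1 / 4) / M) = p - 1 / 4 := by field_simp
    have hMM : M * (1 / M : ℝ) = 1 := by field_simp
    set y := (p - 1 / 4) / M
    have h1 : w ≤ y := le_of_mul_le_mul_left (by linarith [hp.1]) hM'
    have h2 : y ≤ w + 1 / M := le_of_mul_le_mul_left (by rw [mul_add]; linarith [hp.2]) hM'
    have hy : y ∈ Icc a b := ⟨hwa.trans h1, h2.trans hwb⟩
    refine ⟨y, hy, by linarith, (hLip y (hsub hy) x (hsub hx)).trans ?_⟩
    have h3 : |y - x| ≤ 1 / M := abs_le.mpr ⟨by linarith, by linarith⟩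
    calc L * |y - x| ≤ L * (1 / M) := by gcongr
      _ = L / M := by ring
      _ ≤ θ := (div_le_iff₀ hM').mpr hLM
  obtain ⟨⟨p, hp, hp0⟩, q, hq, hq2⟩ := exists_triWave_extrema (M * w + 1 / 4)
  obtain ⟨y, hy, rfl, hFy⟩ := pull p hp
  obtain ⟨y', hy', rfl, hFy'⟩ := pull q hq
  have hzx := abs_le.mp hzx
  have hFy := abs_le.mp hFy
  have hFy' := abs_le.mp hFy'
  obtain ⟨t, ht, htz⟩ : z ∈ h '' Icc a b :=
    (isPreconnected_Icc.image h hcont).Icc_subset (mem_image_of_mem h hy)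
      (mem_image_of_mem h hy')
      ⟨by simp only [hh, hp0]; linarith, by simp only [hh, hq2]; linarith⟩
  exact ⟨t, ht, by change foldI (h t) = z; rw [htz, foldI_eq_self hz]⟩

end Wiggle

/-- A Lipschitz approximation of a continuous self-map of the unit interval by a map with values in
the interior. -/
lemma exists_lipschitz_approx (f : C(unitI, unitI)) {θ : ℝ} (hθ : 0 < θ) (hθ' : θ ≤ 1 / 100) :
    ∃ F : ℝ → ℝ, Continuous F ∧ (∀ x ∈ Icc (0 : ℝ) 1, F x ∈ Icc θ (1 - θ)) ∧
      (∀ x : unitI, |F x - f x| ≤ 4 * θ) ∧ ∃ L, 0 ≤ L ∧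
        ∀ x ∈ Icc (0 : ℝ) 1, ∀ y ∈ Icc (0 : ℝ) 1, |F x - F y| ≤ L * |x - y| := by
  obtain ⟨p, hp⟩ := exists_polynomial_near_of_continuousOn 0 1
    (IccExtend zero_le_one fun x ↦ (f x : ℝ)) (by
      have : Continuous fun x ↦ (f x : ℝ) := by fun_prop
      exact this.Icc_extend'.continuousOn) θ hθ
  have hpf : ∀ x : unitI, |p.eval (x : ℝ) - f x| < θ := fun x ↦ by
    have := hp x x.2
    rwa [IccExtend_of_mem _ _ x.2] at this
  have hbd : ∀ x : unitI, p.eval (x : ℝ) ∈ Icc (-θ) (1 + θ) := fun x ↦ by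
    have h1 := abs_lt.mp (hpf x)
    have h2 := (f x).2
    exact ⟨by linarith [h2.1], by linarith [h2.2]⟩
  refine ⟨fun x ↦ (1 - 4 * θ) * p.eval x + 2 * θ, by fun_prop, fun x hx ↦ ?_, fun x ↦ ?_, ?_⟩
  · have := hbd ⟨x, hx⟩
    simp only [mem_Icc] at this ⊢
    constructor <;> nlinarith [this.1, this.2]
  · have h1 := abs_lt.mp (hpf x)
    have h2 := hbd x
    simp only [mem_Icc] at h2
    exact abs_le.mpr ⟨by nlinarith, by nlinarith⟩
  · obtain ⟨K, hK⟩ := (ContDiff.contDiffOn (s := Icc (0 : ℝ) 1) (n := 1)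
      (f := fun x : ℝ ↦ (1 - 4 * θ) * p.eval x + 2 * θ)
      ((contDiff_const.mul (by simpa using p.contDiff_aeval (𝕜 := ℝ) 1)).add contDiff_const)
      ).exists_lipschitzOnWith one_ne_zero (convex_Icc 0 1) isCompact_Icc
    exact ⟨K, K.2, fun x hx y hy ↦ by simpa [Real.dist_eq] using hK.dist_le_mul x hx y hy⟩

/-- Every map with dense periodic points is approximated by locally eventually onto maps that send
the endpoints of the interval to interior points. -/
lemma exists_leo_near {f : C(unitI, unitI)} (hf : f ∈ CP) {ε : ℝ} (hε : 0 < ε) :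
    ∃ g : C(unitI, unitI), Leo g ∧ dist g f < ε ∧ g 0 ∈ Ioo 0 1 ∧ g 1 ∈ Ioo 0 1 := by
  obtain ⟨θ, hθ, hθ1, hθε⟩ : ∃ θ : ℝ, 0 < θ ∧ θ ≤ 1 / 100 ∧ 14 * θ < ε :=
    ⟨min (1 / 100) (ε / 15), by positivity, min_le_left _ _, by
      linarith [min_le_right (1 / 100) (ε / 15)]⟩
  obtain ⟨F, hFc, hF01, hFf, L, hL, hLip⟩ := exists_lipschitz_approx f hθ hθ1
  obtain ⟨M, hM⟩ := exists_nat_gt ((L + 16) / θ)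
  have hMpos : 0 < M := Nat.cast_pos.mp (lt_of_le_of_lt (by positivity) hM)
  have hM' : (0 : ℝ) < M := Nat.cast_pos.mpr hMpos
  have hLM : L + 16 < θ * M := by rw [div_lt_iff₀ hθ] at hM; linarith
  have hmaps : MapsTo F (Icc 0 1) (Icc 0 1) := fun x hx ↦
    ⟨hθ.le.trans (hF01 x hx).1, (hF01 x hx).2.trans (by linarith)⟩
  have hwave := fun x ↦ abs_le.mp (abs_wave_le (c := 40 * θ) (by positivity) x)
  have hmem : ∀ x : unitI, wiggle F (40 * θ) M x ∈ Icc (0 : ℝ) 1 := fun x ↦ foldI_mem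
    ⟨by linarith [(hmaps x.2).1, (hwave (M * x + 1 / 4)).1],
      by linarith [(hmaps x.2).2, (hwave (M * x + 1 / 4)).2]⟩
  have hcont : Continuous (wiggle F (40 * θ) M) := by
    have := continuous_triWave
    exact continuous_foldI.comp (by fun_prop)
  set g : C(unitI, unitI) :=
    ⟨fun x ↦ ⟨wiggle F (40 * θ) M x, hmem x⟩, by fun_prop⟩ with hg
  have hgx : ∀ x, (g x : ℝ) = wiggle F (40 * θ) M x := fun _ ↦ rfl
  have h2M : 2 / (M : ℝ) ≤ θ := (div_le_iff₀ hM').mpr (by linarith)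
  have hend : ∀ k : ℕ, (k : ℝ) ∈ Icc (0 : ℝ) 1 →
      wiggle F (40 * θ) M k = F k := fun k hk ↦ by
    unfold wiggle
    have := triWave_nat_add_quarter (M * k)
    push_cast at this
    rw [this, sub_self, mul_zero, add_zero, foldI_eq_self (hmaps hk)]
  refine ⟨g, ?_, ?_, ?_, ?_⟩
  · refine leo_of_expanding g (l := 2 / M) (by linarith) (fun a b hab ↦ ?_) fun a b hab ↦ ?_
    · obtain ⟨u, hu, v, hv, huv⟩ := exists_wiggle_expanding hFc.continuousOn hmaps hLip
        (c := 40 * θ) (by positivity) (by linarith) hMpos (by nlinarith) (by nlinarith)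
        a.2.1 hab b.2.2
      exact ⟨⟨u, a.2.1.trans hu.1, hu.2.trans b.2.2⟩, hu, ⟨v, a.2.1.trans hv.1, hv.2.trans b.2.2⟩,
        hv, huv⟩
    · refine exists_iterate_image_eq_univ hf.2 hθ (by linarith) h2M (fun a b hab x hx z hz ↦ ?_)
        a b hab ?_
      · rw [Subtype.dist_eq, Real.dist_eq] at hz
        obtain ⟨t, ht, htz⟩ := mem_wiggle_image (z := z) (x := x) hFc.continuousOn hLip hL
          (θ := θ) (c := 40 * θ) hMpos (by linarith) a.2.1 b.2.2 hab hx z.2 (by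
            have h1 := abs_le.mp hz
            have h2 := abs_le.mp (hFf x)
            exact abs_le.mpr ⟨by linarith, by linarith⟩)
        exact ⟨⟨t, a.2.1.trans ht.1, ht.2.trans b.2.2⟩, ht, Subtype.ext htz⟩
      · have : (0 : ℝ) < 2 / M := by positivity
        exact Subtype.coe_le_coe.mp (by linarith)
  · refine lt_of_le_of_lt ((ContinuousMap.dist_le (by positivity)).mpr fun x ↦ ?_) hθε
    rw [Subtype.dist_eq, Real.dist_eq, hgx]
    refine (abs_foldI_sub_le (f x).2).trans ?_
    have h1 := hwave (M * x + 1 / 4)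
    have h2 := abs_le.mp (hFf x)
    exact abs_le.mpr ⟨by linarith, by linarith⟩
  · have h1 := hend 0 (by simp)
    have h2 := hF01 0 (by simp)
    rw [Nat.cast_zero] at h1
    exact ⟨Subtype.coe_lt_coe.mp (by rw [hgx]; simp only [Icc.coe_zero]; linarith [h2.1]),
      Subtype.coe_lt_coe.mp (by rw [hgx]; simp only [Icc.coe_zero, Icc.coe_one]; linarith [h2.2])⟩
  · have h1 := hend 1 (by simp)
    have h2 := hF01 1 (by simp)
    rw [Nat.cast_one] at h1
    exact ⟨Subtype.coe_lt_coe.mp (by rw [hgx]; simp only [Icc.coe_zero, Icc.coe_one]; linarith [h2.1]),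
      Subtype.coe_lt_coe.mp (by rw [hgx]; simp only [Icc.coe_one]; linarith [h2.2])⟩

lemma surjective_of_mem_closure_CP {f : C(unitI, unitI)} (hf : f ∈ closure CP) :
    Surjective f := by
  intro y
  have hcl : IsClosed (range f) := (isCompact_range f.continuous).isClosed
  refine hcl.closure_subset (Metric.mem_closure_iff.mpr fun ε hε ↦ ?_)
  obtain ⟨g, hg, hfg⟩ := Metric.mem_closure_iff.mp hf ε hε
  obtain ⟨x, rfl⟩ := hg.1 y
  exact ⟨f x, mem_range_self x, by
    rw [dist_comm]; exact (ContinuousMap.dist_apply_le_dist x).trans_lt hfg⟩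

/-- The maps some iterate of which stretches a subinterval of `B` over a set `(e, e')` such that
only points of `(e, e')` are mapped to the endpoints of the unit interval. -/
def stretching (B : Set unitI) : Set C(unitI, unitI) :=
  {f | ∃ (n : ℕ) (e e' x y : unitI), uIcc x y ⊆ B ∧ MapsTo f (Iic e ∪ Ici e') (Ioo 0 1) ∧
    (⇑f)^[n] x < e ∧ e' < (⇑f)^[n] y}

lemma continuous_iterate_eval (n : ℕ) (x : unitI) :
    Continuous fun f : C(unitI, unitI) ↦ (⇑f)^[n] x := by
  induction n with
  | zero => exact continuous_const
  | succ n ih =>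
    simp only [iterate_succ_apply']
    exact continuous_eval.comp (continuous_id.prodMk ih)

lemma isOpen_stretching (B : Set unitI) : IsOpen (stretching B) := by
  refine isOpen_iff_forall_mem_open.mpr ?_
  rintro f ⟨n, e, e', x, y, hB, hmaps, hx, hy⟩
  refine ⟨{g | MapsTo g (Iic e ∪ Ici e') (Ioo 0 1)} ∩
    ({g | (⇑g)^[n] x < e} ∩ {g | e' < (⇑g)^[n] y}), ?_, ?_, hmaps, hx, hy⟩
  · rintro g ⟨h1, h2, h3⟩
    exact ⟨n, e, e', x, y, hB, h1, h2, h3⟩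
  · exact (ContinuousMap.isOpen_setOfPred_mapsTo (isClosed_Iic.union isClosed_Ici).isCompact
      isOpen_Ioo).inter ((isOpen_lt (continuous_iterate_eval n x) continuous_const).inter
        (isOpen_lt continuous_const (continuous_iterate_eval n y)))

lemma exists_iterate_image_eq_univ_of_mem_stretching {B : Set unitI} {f : C(unitI, unitI)}
    (hf : f ∈ stretching B) (hsurj : Surjective f) : ∃ n : ℕ, (⇑f)^[n] '' B = univ := by
  obtain ⟨n, e, e', x, y, hB, hmaps, hx, hy⟩ := hf
  have hpre : IsPreconnected ((⇑f)^[n] '' uIcc x y) :=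
    isPreconnected_uIcc.image _ (f.continuous.iterate n).continuousOn
  have hend : ∀ z : unitI, z ∉ Ioo 0 1 → z ∈ f '' ((⇑f)^[n] '' uIcc x y) := by
    intro z hz
    obtain ⟨w, rfl⟩ := hsurj z
    have hw : w ∉ Iic e ∪ Ici e' := fun h ↦ hz (hmaps h)
    simp only [mem_union, mem_Iic, mem_Ici, not_or, not_le] at hw
    exact mem_image_of_mem f (hpre.Icc_subset (mem_image_of_mem _ left_mem_uIcc)
      (mem_image_of_mem _ right_mem_uIcc) ⟨(hx.trans hw.1).le, (hw.2.trans hy).le⟩)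
  refine ⟨n + 1, univ_subset_iff.mp fun z _ ↦ image_mono hB ?_⟩
  rw [iterate_succ', image_comp]
  exact (hpre.image f f.continuous.continuousOn).Icc_subset (hend 0 (by simp)) (hend 1 (by simp))
    ⟨unitInterval.nonneg', unitInterval.le_one'⟩

lemma Leo.mem_stretching {f : C(unitI, unitI)} (hf : Leo f) (h0 : f 0 ∈ Ioo 0 1)
    (h1 : f 1 ∈ Ioo 0 1) {B : Set unitI} (hB : IsOpen B) (hne : B.Nonempty) :
    f ∈ stretching B := by
  have hopen : IsOpen (f ⁻¹' Ioo 0 1) := isOpen_Ioo.preimage f.continuous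
  obtain ⟨u, hu, husub⟩ := (mem_nhdsGE_iff_exists_Ico_subset' (zero_lt_one (α := unitI))).mp
    (mem_nhdsWithin_of_mem_nhds (hopen.mem_nhds h0))
  obtain ⟨l, hl, hlsub⟩ := (mem_nhdsLE_iff_exists_Ioc_subset' (zero_lt_one (α := unitI))).mp
    (mem_nhdsWithin_of_mem_nhds (hopen.mem_nhds h1))
  obtain ⟨e, he, heu⟩ := exists_between (mem_Ioi.mp hu)
  obtain ⟨e', hle', he'⟩ := exists_between (mem_Iio.mp hl)
  obtain ⟨a, b, hab, hsub⟩ := exists_Icc_subset_of_isOpen hB hne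
  obtain ⟨n, hn⟩ := hf (Ioo a b) isOpen_Ioo (nonempty_Ioo.mpr hab)
  obtain ⟨x, hx, hx0⟩ : 0 ∈ (⇑f)^[n] '' Ioo a b := hn ▸ mem_univ _
  obtain ⟨y, hy, hy1⟩ : 1 ∈ (⇑f)^[n] '' Ioo a b := hn ▸ mem_univ _
  refine ⟨n, e, e', x, y, ?_, ?_, by rw [hx0]; exact he, by rw [hy1]; exact he'⟩
  · exact (uIcc_subset_Icc (Ioo_subset_Icc_self hx) (Ioo_subset_Icc_self hy)).trans hsub
  · rintro z (hz | hz)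
    · exact husub ⟨unitInterval.nonneg', lt_of_le_of_lt hz heu⟩
    · exact hlsub ⟨lt_of_lt_of_le hle' hz, unitInterval.le_one'⟩

lemma leo_of_forall_mem_stretching {f : C(unitI, unitI)} (hsurj : Surjective f)
    (hf : ∀ B ∈ TopologicalSpace.countableBasis unitI, f ∈ stretching B) : Leo f := by
  rintro U hU ⟨x, hx⟩
  obtain ⟨B, hB, -, hBU⟩ :=
    (TopologicalSpace.isBasis_countableBasis unitI).exists_subset_of_mem_open hx hU
  obtain ⟨n, hn⟩ := exists_iterate_image_eq_univ_of_mem_stretching (hf B hB) hsurj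
  exact ⟨n, univ_subset_iff.mp (hn ▸ image_mono hBU)⟩

/-- The piecewise linear map with four full laps. -/
noncomputable def fourLap : C(unitI, unitI) where
  toFun x := ⟨2 * triWave (2 * x), by linarith [triWave_nonneg (2 * x)],
    by linarith [triWave_le_half (2 * x)]⟩
  continuous_toFun := by
    have := continuous_triWave
    fun_prop

lemma coe_fourLap (x : unitI) : (fourLap x : ℝ) = 2 * triWave (2 * x) := rfl

lemma leo_fourLap : Leo fourLap := by
  refine leo_of_expanding fourLap (l := 1 / 2) (by norm_num) (fun a b hab ↦ ?_) fun a b hab ↦ ?_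
  · have hab' : (0 : ℝ) < b - a := sub_pos.mpr hab
    have ha := a.2.1
    have hb := b.2.2
    set d := min ((b : ℝ) - a) (1 / 4) with hd
    have hdpos : 0 < d := lt_min hab' (by norm_num)
    have hdb : d ≤ b - a := min_le_left _ _
    have hd4 : d ≤ 1 / 4 := min_le_right _ _
    have hgoal : min (2 * ((b : ℝ) - a)) (1 / 2) = 2 * d := by
      rw [hd, mul_min_of_nonneg _ _ zero_le_two]; norm_num
    have hsplit := triWave_half_isometry (u := 2 * a) (v := 2 * (a + d)) (by linarith) (by linarith)
    rw [show (2 * a + 2 * (a + d)) / 2 = 2 * (a + d / 2) by ring,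
      show (2 * (a + d) - 2 * (a : ℝ)) / 2 = d by ring] at hsplit
    have hm : a + d / 2 ∈ Icc (a : ℝ) b := ⟨by linarith, by linarith⟩
    have he : a + d ∈ Icc (a : ℝ) b := ⟨by linarith, by linarith⟩
    let m : unitI := ⟨a + d / 2, ha.trans hm.1, hm.2.trans hb⟩
    let e : unitI := ⟨a + d, ha.trans he.1, he.2.trans hb⟩
    rw [hgoal]
    rcases hsplit with h | h
    · refine ⟨m, hm, a, left_mem_Icc.mpr hab.le, ?_⟩
      rw [coe_fourLap, coe_fourLap, ← mul_sub, abs_mul, h, abs_two]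
    · refine ⟨e, he, m, hm, ?_⟩
      rw [coe_fourLap, coe_fourLap, ← mul_sub, abs_mul, h, abs_two]
  · refine ⟨1, univ_subset_iff.mp fun z _ ↦ ?_⟩
    have ha := a.2.1
    have hb := b.2.2
    obtain ⟨⟨p, hp, hp0⟩, q, hq, hq1⟩ := exists_triWave_extrema (2 * a)
    have pull : ∀ p ∈ Icc (2 * (a : ℝ)) (2 * a + 1),
        ∃ y : unitI, y ∈ Icc a b ∧ (fourLap y : ℝ) = 2 * triWave p := fun p hp ↦
      ⟨⟨p / 2, by linarith [hp.1], by linarith [hp.2]⟩,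
        ⟨Subtype.coe_le_coe.mp (by linarith [hp.1]), Subtype.coe_le_coe.mp (by linarith [hp.2])⟩,
        by rw [coe_fourLap, mul_div_cancel₀ p two_ne_zero]⟩
    obtain ⟨y, hy, hy0⟩ := pull p hp
    obtain ⟨y', hy', hy1⟩ := pull q hq
    rw [iterate_one]
    refine (isPreconnected_Icc.image fourLap fourLap.continuous.continuousOn).Icc_subset
      (mem_image_of_mem _ hy) (mem_image_of_mem _ hy')
      ⟨Subtype.coe_le_coe.mp ?_, Subtype.coe_le_coe.mp ?_⟩
    · rw [hy0, hp0]; linarith [z.2.1]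
    · rw [hy1, hq1]; linarith [z.2.2]

/-- Arbitrarily close to `fourLap` there are maps with dense periodic points that leave a small
interval invariant. -/
lemma exists_mem_CP_not_leo_near_fourLap {ε : ℝ} (hε : 0 < ε) :
    ∃ g ∈ CP, ¬ Leo ⇑g ∧ dist g fourLap < ε := by
  obtain ⟨s, hs, hs1, hsε⟩ : ∃ s : ℝ, 0 < s ∧ s ≤ 1 / 2 ∧ 6 * s < ε :=
    ⟨min (1 / 2) (ε / 7), by positivity, min_le_left _ _, by
      linarith [min_le_right (1 / 2) (ε / 7)]⟩
  have hs1' : 0 < 1 - s := by linarith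
  set φ : unitI → unitI := fun t ↦ ⟨s + (1 - s) * t, by have := t.2.1; positivity,
    by nlinarith [t.2.2]⟩ with hφ
  have hφc : Continuous φ := by fun_prop
  set G : ℝ → ℝ := fun x ↦ min x s + (1 - s) * (2 * triWave (2 * (max (x - s) 0 / (1 - s))))
    with hG
  have hGc : Continuous G := by
    have := continuous_triWave
    fun_prop
  have hGlow : ∀ x ≤ s, G x = x := fun x hx ↦ by
    have : triWave 0 = 0 := by simpa using triWave_int 0
    simp only [hG, min_eq_left hx, max_eq_right (sub_nonpos.mpr hx), zero_div, mul_zero, this,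
      add_zero]
  have hGhigh : ∀ x, s ≤ x → G x = s + (1 - s) * (2 * triWave (2 * ((x - s) / (1 - s)))) :=
    fun x hx ↦ by simp only [hG, min_eq_right hx, max_eq_left (sub_nonneg.mpr hx)]
  have hGmem : ∀ x : unitI, G x ∈ Icc (0 : ℝ) 1 := fun x ↦ by
    have h1 := triWave_nonneg (2 * (max (x - s) 0 / (1 - s)))
    have h2 := triWave_le_half (2 * (max (x - s) 0 / (1 - s)))
    have h3 := min_le_right (x : ℝ) s
    have h4 : 0 ≤ min (x : ℝ) s := le_min x.2.1 hs.le
    exact ⟨by simp only [hG]; positivity, by simp only [hG]; nlinarith⟩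
  set g : C(unitI, unitI) := ⟨fun x ↦ ⟨G x, hGmem x⟩, by fun_prop⟩ with hg
  have hgx : ∀ x, (g x : ℝ) = G x := fun _ ↦ rfl
  have hfix : ∀ x : unitI, (x : ℝ) ≤ s → g x = x := fun x hx ↦ Subtype.ext (hGlow x hx)
  have hsemi : Semiconj φ fourLap g := fun t ↦ Subtype.ext (by
    have h1 : s ≤ φ t := by simp only [hφ]; nlinarith [t.2.1]
    rw [hgx, hGhigh _ h1]
    simp only [hφ, coe_fourLap, add_sub_cancel_left, mul_div_cancel_left₀ _ hs1'.ne'])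
  have hφsurj : ∀ y : unitI, s ≤ y → ∃ t, φ t = y := fun y hy ↦
    ⟨⟨(y - s) / (1 - s), div_nonneg (by linarith) hs1'.le,
      (div_le_one hs1').mpr (by linarith [y.2.2])⟩, Subtype.ext (by simp only [hφ]; field_simp; ring)⟩
  have hCP := leo_fourLap.mem_CP
  refine ⟨g, ⟨fun y ↦ ?_, fun y ↦ ?_⟩, fun hleo ↦ ?_, ?_⟩
  · rcases le_total (y : ℝ) s with hy | hy
    · exact ⟨y, hfix y hy⟩
    · obtain ⟨t, rfl⟩ := hφsurj y hy
      obtain ⟨r, rfl⟩ := hCP.1 t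
      exact ⟨φ r, (hsemi r).symm⟩
  · rcases le_total (y : ℝ) s with hy | hy
    · exact subset_closure (mk_mem_periodicPts one_pos (hfix y hy))
    · obtain ⟨t, rfl⟩ := hφsurj y hy
      exact map_mem_closure hφc (hCP.2 t) hsemi.mapsTo_periodicPts
  · set U : Set unitI := {x | (x : ℝ) < s} with hU
    obtain ⟨n, hn⟩ := hleo U (isOpen_lt continuous_subtype_val continuous_const) ⟨0, hs⟩
    obtain ⟨x, hx, hx1⟩ : 1 ∈ (⇑g)^[n] '' U := hn ▸ mem_univ _
    rw [iterate_fixed (hfix x (le_of_lt hx))] at hx1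
    subst hx1
    exact absurd hx (by simp only [hU, mem_ofPred_eq, Icc.coe_one]; linarith)
  · refine lt_of_le_of_lt ((ContinuousMap.dist_le (by positivity)).mpr fun x ↦ ?_) hsε
    rw [Subtype.dist_eq, Real.dist_eq, hgx, coe_fourLap]
    have hx := x.2
    set w := max ((x : ℝ) - s) 0 / (1 - s) with hw
    have hwx : |w - x| ≤ s := by
      rcases le_total (x : ℝ) s with h | h
      · rw [hw, max_eq_right (sub_nonpos.mpr h), zero_div, zero_sub, abs_neg, abs_of_nonneg hx.1]
        exact h
      · rw [hw, max_eq_left (sub_nonneg.mpr h), abs_le]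
        constructor
        · rw [neg_le_sub_iff_le_add, ← sub_le_iff_le_add, le_div_iff₀ hs1']
          nlinarith
        · rw [sub_le_iff_le_add, div_le_iff₀ hs1']
          nlinarith [hx.2]
    have h1 : |triWave (2 * w) - triWave (2 * x)| ≤ 2 * s := by
      refine (abs_triWave_sub_le _ _).trans ?_
      rw [← mul_sub, abs_mul, abs_two]
      linarith
    have h1 := abs_le.mp h1
    have h2 := triWave_nonneg (2 * w)
    have h3 := triWave_le_half (2 * w)
    have h4 := min_le_right (x : ℝ) s
    have h5 : 0 ≤ min (x : ℝ) s := le_min hx.1 hs.le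
    change |min (x : ℝ) s + (1 - s) * (2 * triWave (2 * w)) - 2 * triWave (2 * x)| ≤ 6 * s
    exact abs_le.mpr ⟨by nlinarith, by nlinarith⟩

/-- The set of locally eventually onto maps is residual (contains a dense `Gδ`) in
`cl(CP)` with the uniform metric, but it is not an open subset of `cl(CP)`. -/
theorem leo_residual_not_open_in_closure_CP :
    (∃ S : Set (closure CP : Set C(unitI, unitI)),
        IsGδ S ∧ Dense S ∧ ∀ f ∈ S, Leo ⇑(f : C(unitI, unitI))) ∧
    ¬ IsOpen {f : (closure CP : Set C(unitI, unitI)) | Leo ⇑(f : C(unitI, unitI))} := by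
  constructor
  · refine ⟨⋂ B ∈ TopologicalSpace.countableBasis unitI, Subtype.val ⁻¹' stretching B, ?_, ?_, ?_⟩
    · exact IsGδ.biInter (TopologicalSpace.countable_countableBasis unitI) fun B _ ↦
        ((isOpen_stretching B).preimage continuous_subtype_val).isGδ
    · refine Metric.dense_iff.mpr fun f r hr ↦ ?_
      obtain ⟨f', hf', hff'⟩ := Metric.mem_closure_iff.mp f.2 (r / 2) (half_pos hr)
      obtain ⟨g, hg, hgf, h0, h1⟩ := exists_leo_near hf' (half_pos hr)
      refine ⟨⟨g, subset_closure hg.mem_CP⟩, ?_, mem_iInter₂.mpr fun B hB ↦ ?_⟩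
      · rw [mem_ball, Subtype.dist_eq]
        linarith [dist_triangle_right g f.1 f']
      · exact hg.mem_stretching h0 h1 (TopologicalSpace.isOpen_of_mem_countableBasis hB)
          (TopologicalSpace.nonempty_of_mem_countableBasis hB)
    · exact fun f hf ↦ leo_of_forall_mem_stretching (surjective_of_mem_closure_CP f.2)
        fun B hB ↦ mem_iInter₂.mp hf B hB
  · intro hopen
    obtain ⟨ε, hε, hball⟩ := Metric.isOpen_iff.mp hopen
      ⟨fourLap, subset_closure leo_fourLap.mem_CP⟩ leo_fourLap
    obtain ⟨g, hg, hleo, hdist⟩ := exists_mem_CP_not_leo_near_fourLap hε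
    exact hleo (hball (show (⟨g, subset_closure hg⟩ : closure CP) ∈ ball _ ε from hdist))
end

section
/- For every f ∈ cl(CP), the conjugacy class G_f = {ψ⁻¹ ∘ f ∘ ψ : ψ a homeomorphism of I} is a nowhere dense subset of (cl(CP), ρ). -/
open Set Function Metric

/-- The conjugacy class of `f`: all maps `ψ⁻¹ ∘ f ∘ ψ` for `ψ` a homeomorphism of `I`. -/
def ConjClass (f : C(unitI, unitI)) : Set C(unitI, unitI) :=
  {g | ∃ ψ : unitI ≃ₜ unitI, ∀ x, g x = ψ.symm (f (ψ x))}

/-- The triangle wave of period `2`, equal to `|t|` on `[-1, 1]`. -/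
noncomputable def triangleWave (t : ℝ) : ℝ := ‖(t : AddCircle (2 : ℝ))‖

namespace triangleWave

lemma abs_sub_le (s t : ℝ) : |triangleWave s - triangleWave t| ≤ |s - t| := by
  unfold triangleWave
  refine (abs_norm_sub_norm_le _ _).trans ?_
  rw [← AddCircle.coe_sub]
  exact QuotientAddGroup.norm_mk_le_norm

lemma continuous : Continuous triangleWave :=
  (LipschitzWith.of_dist_le_mul (K := 1) fun s t => by
    simpa [Real.dist_eq] using abs_sub_le s t).continuous

lemma nonneg (t : ℝ) : 0 ≤ triangleWave t := norm_nonneg _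

lemma le_one (t : ℝ) : triangleWave t ≤ 1 := by
  simpa [triangleWave] using
    AddCircle.norm_le_half_period (2 : ℝ) (x := (t : AddCircle (2 : ℝ))) two_ne_zero

lemma mem_Icc (t : ℝ) : triangleWave t ∈ Icc (0 : ℝ) 1 := ⟨nonneg t, le_one t⟩

lemma eq_abs {t : ℝ} (ht : |t| ≤ 1) : triangleWave t = |t| :=
  (AddCircle.norm_coe_eq_abs_iff (2 : ℝ) two_ne_zero).2 (by simpa using ht)

lemma eq_self {t : ℝ} (h0 : 0 ≤ t) (h1 : t ≤ 1) : triangleWave t = t := by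
  rw [eq_abs (by rwa [abs_of_nonneg h0]), abs_of_nonneg h0]

lemma sub_two_mul_int (t : ℝ) (k : ℤ) : triangleWave (t - 2 * k) = triangleWave t := by
  unfold triangleWave
  have h : ((2 * (k : ℝ) : ℝ) : AddCircle (2 : ℝ)) = 0 :=
    (AddCircle.coe_eq_zero_iff 2).2 ⟨k, by simp [mul_comm]⟩
  rw [AddCircle.coe_sub, h, sub_zero]

lemma eq_of_even {n k : ℤ} (hk : n = k + k) {t : ℝ} (h0 : (n : ℝ) ≤ t) (h1 : t ≤ n + 1) :
    triangleWave t = t - n := by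
  subst hk
  push_cast at *
  rw [← sub_two_mul_int t k, eq_self] <;> linarith

lemma eq_of_odd {n k : ℤ} (hk : n = 2 * k + 1) {t : ℝ} (h0 : (n : ℝ) ≤ t) (h1 : t ≤ n + 1) :
    triangleWave t = n + 1 - t := by
  subst hk
  push_cast at *
  rw [← sub_two_mul_int t (k + 1), eq_abs] <;> push_cast
  · rw [abs_of_nonpos] <;> linarith
  · rw [abs_le]; constructor <;> linarith

lemma abs_sub_eq (n : ℤ) {s t : ℝ} (hs0 : (n : ℝ) ≤ s) (hs1 : s ≤ n + 1)
    (ht0 : (n : ℝ) ≤ t) (ht1 : t ≤ n + 1) :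
    |triangleWave s - triangleWave t| = |s - t| := by
  rcases Int.even_or_odd n with ⟨k, hk⟩ | ⟨k, hk⟩
  · rw [eq_of_even hk hs0 hs1, eq_of_even hk ht0 ht1]
    congr 1; ring
  · rw [eq_of_odd hk hs0 hs1, eq_of_odd hk ht0 ht1, abs_sub_comm s]
    congr 1; ring

lemma int_add_half (n : ℤ) : triangleWave (n + 1 / 2) = 1 / 2 := by
  rcases Int.even_or_odd n with ⟨k, hk⟩ | ⟨k, hk⟩
  · rw [eq_of_even hk] <;> linarith
  · rw [eq_of_odd hk] <;> linarith

lemma int_values (n : ℤ) : (triangleWave n = 0 ∧ triangleWave (n + 1) = 1) ∨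
    (triangleWave n = 1 ∧ triangleWave (n + 1) = 0) := by
  rcases Int.even_or_odd n with ⟨k, hk⟩ | ⟨k, hk⟩
  · left; constructor <;> rw [eq_of_even hk] <;> linarith
  · right; constructor <;> rw [eq_of_odd hk] <;> linarith

/-- A short interval has a subinterval of at least half its length on which the wave is isometric. -/
lemma exists_isometric_subinterval {u v : ℝ} (huv : u < v) (h : v - u ≤ 1) :
    ∃ u' v', u ≤ u' ∧ u' ≤ v' ∧ v' ≤ v ∧ (v - u) / 2 ≤ v' - u' ∧
      |triangleWave v' - triangleWave u'| = v' - u' := by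
  have h0 := Int.floor_le u
  have h1 := Int.lt_floor_add_one u
  set n := ⌊u⌋
  rcases le_total v (n + 1) with hv | hv
  · refine ⟨u, v, le_rfl, huv.le, le_rfl, by linarith, ?_⟩
    rw [abs_sub_eq n (by linarith) hv h0 h1.le, abs_of_pos (by linarith)]
  rcases le_total ((v - u) / 2) (n + 1 - u) with hm | hm
  · refine ⟨u, n + 1, le_rfl, h1.le, hv, hm, ?_⟩
    rw [abs_sub_eq n (by linarith) le_rfl h0 h1.le, abs_of_nonneg (by linarith)]
  · refine ⟨n + 1, v, h1.le, hv, le_rfl, by linarith, ?_⟩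
    rw [abs_sub_eq (n + 1), abs_of_nonneg] <;> push_cast <;> linarith

end triangleWave

lemma exists_interval_of_length (x : unitI) {t : ℝ} (ht : 0 ≤ t) (ht2 : t ≤ 1 / 2) :
    ∃ a b : unitI, a ≤ x ∧ x ≤ b ∧ (b : ℝ) - a = t := by
  obtain ⟨x, hx0, hx1⟩ := x
  rcases le_total (x + t) 1 with h | h
  · exact ⟨⟨x, hx0, hx1⟩, ⟨x + t, by linarith, h⟩, le_rfl, Subtype.mk_le_mk.2 (by linarith), by simp⟩
  · exact ⟨⟨x - t, by linarith, by linarith⟩, ⟨x, hx0, hx1⟩, Subtype.mk_le_mk.2 (by linarith),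
      le_rfl, by simp⟩

lemma exists_Icc_subset_image_of_expanding {h : C(unitI, unitI)} {l : ℝ} (hl : 0 < l)
    (expand : ∀ a b : unitI, a < b → (b : ℝ) - a ≤ l →
      ∃ c ∈ Icc a b, ∃ d ∈ Icc a b, 2 * ((b : ℝ) - a) ≤ |(h d : ℝ) - h c|) (k : ℕ) :
    ∀ a b : unitI, a < b → 2 * l ≤ 2 ^ k * ((b : ℝ) - a) →
      ∃ n, ∃ c d : unitI, 2 * l ≤ (d : ℝ) - c ∧ Icc c d ⊆ h^[n] '' Icc a b := by
  induction k with
  | zero => exact fun a b _ hk => ⟨0, a, b, by simpa using hk, by simp⟩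
  | succ k ih =>
    intro a b hab hk
    have hab' : (a : ℝ) < b := hab
    obtain ⟨b', hab1, hbb, hb'l, hmin⟩ : ∃ b' : unitI, a < b' ∧ b' ≤ b ∧ (b' : ℝ) - a ≤ l ∧
        2 * l ≤ 2 ^ k * (2 * ((b' : ℝ) - a)) := by
      rcases le_total ((b : ℝ) - a) l with hb | hb
      · exact ⟨b, hab, le_rfl, hb, by rw [pow_succ] at hk; linarith⟩
      · refine ⟨⟨a + l, by linarith [a.2.1], by linarith [b.2.2]⟩, ?_, ?_, ?_, ?_⟩
        · exact Subtype.mk_lt_mk.2 (by linarith)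
        · exact Subtype.mk_le_mk.2 (by linarith)
        · simp
        · simp only [add_sub_cancel_left]
          nlinarith [one_le_pow₀ (one_le_two : (1 : ℝ) ≤ 2) (n := k)]
    obtain ⟨c, hc, d, hd, hcd⟩ := expand a b' hab1 hb'l
    have hpos : (0 : ℝ) < b' - a := sub_pos.2 hab1
    have key : ∃ p q : unitI, 2 * ((b' : ℝ) - a) ≤ (q : ℝ) - p ∧ Icc p q ⊆ h '' Icc a b := by
      have sub : uIcc (h c) (h d) ⊆ h '' Icc a b :=
        (intermediate_value_uIcc h.continuous.continuousOn).trans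
          (image_mono ((uIcc_subset_Icc hc hd).trans (Icc_subset_Icc_right hbb)))
      rcases le_total (h c : unitI) (h d) with hle | hle
      · refine ⟨h c, h d, ?_, by rwa [uIcc_of_le hle] at sub⟩
        rwa [abs_of_nonneg (sub_nonneg.2 (Subtype.coe_le_coe.2 hle))] at hcd
      · refine ⟨h d, h c, ?_, by rwa [uIcc_of_ge hle] at sub⟩
        rwa [abs_of_nonpos (sub_nonpos.2 (Subtype.coe_le_coe.2 hle)), neg_sub] at hcd
    obtain ⟨p, q, hpq, hsub⟩ := key
    obtain ⟨n, c', d', hlen, hsub'⟩ := ih p q (Subtype.coe_lt_coe.1 (by linarith))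
      (hmin.trans (by gcongr))
    refine ⟨n + 1, c', d', hlen, hsub'.trans ?_⟩
    rw [iterate_succ, image_comp]
    exact image_mono hsub

/-- A set that, with `x`, contains everything `r`-close to `g x` is empty or everything,
provided the periodic points of `g` are dense. -/
lemma eq_univ_of_pseudoOrbit_closed {g : C(unitI, unitI)} (hg : Dense (periodicPts g)) {r : ℝ}
    (hr : 0 < r) {A : Set unitI} (hA : A.Nonempty)
    (step : ∀ x ∈ A, ∀ y, dist y (g x) ≤ r → y ∈ A) : A = univ := by
  have near : ∀ x ∈ A, ∀ y, dist y x < r / 2 → y ∈ A := by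
    intro x hx y hy
    obtain ⟨δ, hδ, hgδ⟩ := Metric.continuous_iff.1 g.continuous x r hr
    obtain ⟨p, hp, hpx⟩ := hg.exists_dist_lt x (lt_min hδ (half_pos hr))
    rw [dist_comm] at hpx
    obtain ⟨n, hn, hper⟩ := hp
    have orbit : ∀ k, g^[k + 1] p ∈ A := by
      intro k
      induction k with
      | zero => exact step x hx _ (hgδ p (hpx.trans_le (min_le_left _ _))).le
      | succ k ih =>
        refine step _ ih _ ?_
        rw [iterate_succ_apply' g (k + 1), dist_self]
        exact hr.le
    have hret : g (g^[2 * n - 1] p) = p := by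
      rw [← iterate_succ_apply' g, show (2 * n - 1).succ = n * 2 by omega]
      exact hper.mul_const 2
    obtain ⟨k, hk⟩ : ∃ k, 2 * n - 1 = k + 1 := ⟨2 * n - 2, by omega⟩
    refine step _ (hk ▸ orbit k) y ?_
    rw [hret]
    have := dist_triangle y x p
    rw [dist_comm x p] at this
    linarith [hpx.trans_le (min_le_right _ _)]
  refine IsClopen.eq_univ ⟨?_, ?_⟩ hA
  · rw [← isOpen_compl_iff, Metric.isOpen_iff]
    exact fun x hx => ⟨r / 2, half_pos hr, fun y hy hyA =>
      hx (near y hyA x (by rwa [dist_comm]))⟩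
  · rw [Metric.isOpen_iff]
    exact fun x hx => ⟨r / 2, half_pos hr, fun y hy => near x hx y hy⟩

/-- An expanding map whose images of intervals of a given length cover neighbourhoods of the values
of a map with dense periodic points is itself in `CP`. -/
lemma mem_CP_of_expanding_of_covering {g h : C(unitI, unitI)} (hg : Dense (periodicPts g))
    {l r : ℝ} (hl : 0 < l) (hlr : 2 * l ≤ r) (hr : r ≤ 1 / 2)
    (expand : ∀ a b : unitI, a < b → (b : ℝ) - a ≤ l →
      ∃ c ∈ Icc a b, ∃ d ∈ Icc a b, 2 * ((b : ℝ) - a) ≤ |(h d : ℝ) - h c|)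
    (cover : ∀ a b x : unitI, a ≤ x → x ≤ b → (b : ℝ) - a = 2 * l →
      closedBall (g x) (2 * r) ⊆ h '' Icc a b) : h ∈ CP := by
  have hr0 : 0 < r := by linarith
  have reach : ∀ a b : unitI, a < b → ∀ y, ∃ n, closedBall y r ⊆ h^[n + 1] '' Icc a b := by
    intro a b hab
    suffices H : {y | ∃ n, closedBall y r ⊆ h^[n + 1] '' Icc a b} = univ from
      fun y => H.symm.subset (mem_univ y)
    have hball : ∀ z y : unitI, dist y z ≤ r → closedBall y r ⊆ closedBall z (2 * r) :=
      fun z y hyz => closedBall_subset_closedBall' (by linarith)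
    refine eq_univ_of_pseudoOrbit_closed hg hr0 ?_ ?_
    · have hpos : (0 : ℝ) < b - a := sub_pos.2 hab
      obtain ⟨k, hk⟩ := pow_unbounded_of_one_lt (2 * l / ((b : ℝ) - a)) one_lt_two
      rw [div_lt_iff₀ hpos] at hk
      obtain ⟨n, c, d, hcd, hsub⟩ := exists_Icc_subset_image_of_expanding hl expand k a b hab hk.le
      have hc := c.2.1
      have hd := d.2.2
      have hcov := cover c ⟨c + 2 * l, by linarith, by linarith⟩ c le_rfl
        (Subtype.mk_le_mk.2 (by linarith)) (by simp)
      refine ⟨g c, n, (hball (g c) (g c) (by simpa using hr0.le)).trans (hcov.trans ?_)⟩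
      rw [iterate_succ', image_comp]
      refine image_mono ((Icc_subset_Icc_right ?_).trans hsub)
      exact Subtype.mk_le_mk.2 (by linarith)
    · rintro x ⟨n, hn⟩ y hy
      obtain ⟨p, q, hpx, hxq, hpq⟩ := exists_interval_of_length x (by linarith) (hlr.trans hr)
      refine ⟨n + 1, (hball _ _ hy).trans ((cover p q x hpx hxq hpq).trans ?_)⟩
      rw [iterate_succ', image_comp]
      refine image_mono (Subset.trans (fun z hz => ?_) hn)
      have h1 : (p : ℝ) ≤ x := hpx
      have h2 : (x : ℝ) ≤ q := hxq
      have h3 : (p : ℝ) ≤ z := hz.1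
      have h4 : (z : ℝ) ≤ q := hz.2
      rw [mem_closedBall, Subtype.dist_eq, Real.dist_eq, abs_le]
      constructor <;> linarith
  constructor
  · intro y
    obtain ⟨n, hn⟩ := reach ⟨0, by simp⟩ ⟨1, by simp⟩ (by simp) y
    obtain ⟨x, -, hx⟩ := hn (mem_closedBall_self hr0.le)
    exact ⟨h^[n] x, by rw [← iterate_succ_apply' h, hx]⟩
  · refine Metric.dense_iff.2 fun x δ hδ => ?_
    obtain ⟨a, b, hax, hxb, hlen⟩ := exists_interval_of_length x
      (t := min (δ / 2) r) (le_min (by linarith) hr0.le) ((min_le_right _ _).trans hr)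
    have hlt : a < b := Subtype.coe_lt_coe.1 (sub_pos.1 (hlen ▸ lt_min (half_pos hδ) hr0))
    have hlenr := hlen.le.trans (min_le_right _ _)
    have hlenδ := hlen.le.trans (min_le_left _ _)
    obtain ⟨n, hn⟩ := reach a b hlt a
    have hsub : Icc a b ⊆ h^[n + 1] '' Icc a b := by
      refine Subset.trans (fun z hz => ?_) hn
      have h3 : (a : ℝ) ≤ z := hz.1
      have h4 : (z : ℝ) ≤ b := hz.2
      rw [mem_closedBall, Subtype.dist_eq, Real.dist_eq, abs_le]
      constructor <;> linarith
    obtain ⟨c, hc, hca⟩ := hsub (left_mem_Icc.2 hlt.le)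
    obtain ⟨d, hd, hdb⟩ := hsub (right_mem_Icc.2 hlt.le)
    obtain ⟨z, hz, hfix⟩ := exists_mem_uIcc_isFixedPt (a := d) (b := c) (f := h^[n + 1])
      (h.continuous.iterate _).continuousOn (hdb ▸ hd.2) (hca ▸ hc.1)
    have hz' := uIcc_subset_Icc hd hc hz
    refine ⟨z, ?_, n + 1, n.succ_pos, hfix⟩
    have h1 : (a : ℝ) ≤ x := hax
    have h2 : (x : ℝ) ≤ b := hxb
    have h3 : (a : ℝ) ≤ z := hz'.1
    have h4 : (z : ℝ) ≤ b := hz'.2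
    rw [mem_ball, Subtype.dist_eq, Real.dist_eq, abs_lt]
    constructor <;> linarith

/-- A Lipschitz map with a fast triangle wave of amplitude `η` added, folded back into `[0, 1]`. -/
noncomputable def foldedWave (G : ℝ → ℝ) (hG : Continuous G) (η M : ℝ) : C(unitI, unitI) where
  toFun x := ⟨triangleWave (G x + η * (2 * triangleWave (M * x + 1 / 2) - 1)),
    triangleWave.mem_Icc _⟩
  continuous_toFun := by
    have := triangleWave.continuous
    fun_prop

lemma foldedWave_apply {G : ℝ → ℝ} (hG : Continuous G) (η M : ℝ) (x : unitI) :
    (foldedWave G hG η M x : ℝ) =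
      triangleWave (G x + η * (2 * triangleWave (M * x + 1 / 2) - 1)) := rfl

lemma foldedWave_apply_of_int {G : ℝ → ℝ} (hG : Continuous G) (η M : ℝ) (x : unitI) {k : ℤ}
    (hk : M * x = k) (hx : G x ∈ Icc (0 : ℝ) 1) : (foldedWave G hG η M x : ℝ) = G x := by
  rw [foldedWave_apply, hk, triangleWave.int_add_half,
    show G x + η * (2 * (1 / 2) - 1) = G x by ring, triangleWave.eq_self hx.1 hx.2]

lemma dist_foldedWave_le {G : ℝ → ℝ} (hG : Continuous G) {η M r : ℝ} (hη : 0 ≤ η) (hr : 0 ≤ r)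
    {g : C(unitI, unitI)} (hGg : ∀ x : unitI, |G x - g x| ≤ r) :
    dist (foldedWave G hG η M) g ≤ r + η := by
  refine (ContinuousMap.dist_le (by linarith)).2 fun x => ?_
  rw [Subtype.dist_eq, Real.dist_eq, foldedWave_apply,
    ← triangleWave.eq_self (g x).2.1 (g x).2.2]
  refine (triangleWave.abs_sub_le _ _).trans ?_
  have h0 := triangleWave.nonneg (M * x + 1 / 2)
  have h1 := triangleWave.le_one (M * x + 1 / 2)
  obtain ⟨h2, h3⟩ := abs_le.1 (hGg x)
  rw [abs_le]
  constructor <;> nlinarith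

lemma foldedWave_expand {G : ℝ → ℝ} {L : NNReal} (hG : LipschitzWith L G) {η M : ℝ}
    (hη : 0 ≤ η) (hη4 : η ≤ 1 / 4) (hM : 0 < M) (hLM : 2 * L ≤ M) (hslope : L + 8 ≤ 2 * η * M)
    (a b : unitI) (hab : a < b) (hlen : (b : ℝ) - a ≤ 1 / M) :
    ∃ c ∈ Icc a b, ∃ d ∈ Icc a b, 2 * ((b : ℝ) - a) ≤
      |(foldedWave G hG.continuous η M d : ℝ) - foldedWave G hG.continuous η M c| := by
  have hab' : (0 : ℝ) < b - a := sub_pos.2 hab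
  have hlenM : M * ((b : ℝ) - a) ≤ 1 := by
    rw [le_div_iff₀ hM] at hlen
    linarith
  set F : ℝ → ℝ := fun x => G x + η * (2 * triangleWave (M * x + 1 / 2) - 1) with hF
  have hFc : Continuous F := by
    have := triangleWave.continuous
    have := hG.continuous
    fun_prop
  obtain ⟨u, v, hu, huv, hv, hhalf, hiso⟩ := triangleWave.exists_isometric_subinterval
    (u := M * a + 1 / 2) (v := M * b + 1 / 2) (by nlinarith) (by linarith)
  obtain ⟨s, rfl⟩ : ∃ s, u = M * s + 1 / 2 := ⟨(u - 1 / 2) / M, by field_simp; ring⟩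
  obtain ⟨t, rfl⟩ : ∃ t, v = M * t + 1 / 2 := ⟨(v - 1 / 2) / M, by field_simp; ring⟩
  have has : (a : ℝ) ≤ s := le_of_mul_le_mul_left (by linarith) hM
  have hst : s ≤ t := le_of_mul_le_mul_left (by linarith) hM
  have htb : t ≤ b := le_of_mul_le_mul_left (by linarith) hM
  have hhalf' : ((b : ℝ) - a) / 2 ≤ t - s := le_of_mul_le_mul_left (by linarith) hM
  have hGst : |G t - G s| ≤ L * (t - s) := by
    have := hG.dist_le_mul t s
    rwa [Real.dist_eq, Real.dist_eq, abs_of_nonneg (sub_nonneg.2 hst)] at this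
  have hdiff : F t - F s = (G t - G s) +
      2 * η * (triangleWave (M * t + 1 / 2) - triangleWave (M * s + 1 / 2)) := by
    simp only [hF]; ring
  have hwave : |2 * η * (triangleWave (M * t + 1 / 2) - triangleWave (M * s + 1 / 2))| =
      2 * η * (M * (t - s)) := by
    rw [abs_mul, hiso, abs_of_nonneg (by linarith)]
    ring
  have hlow : 4 * ((b : ℝ) - a) ≤ |F t - F s| := by
    have h2 : 8 * (t - s) ≤ (2 * η * M - L) * (t - s) :=
      mul_le_mul_of_nonneg_right (by linarith) (by linarith)
    rw [hdiff, add_comm]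
    have h3 := abs_sub_abs_le_abs_sub
      (2 * η * (triangleWave (M * t + 1 / 2) - triangleWave (M * s + 1 / 2))) (-(G t - G s))
    rw [hwave, abs_neg, sub_neg_eq_add] at h3
    nlinarith
  have hup : |F t - F s| ≤ 1 := by
    rw [hdiff]
    refine (abs_add_le _ _).trans ?_
    rw [hwave]
    have h1 : M * (t - s) ≤ 1 := by nlinarith
    have h2 : 2 * (L * (t - s)) ≤ M * (t - s) := by nlinarith
    nlinarith
  have hne : min (F s) (F t) < max (F s) (F t) := by
    refine min_lt_max.2 fun h => ?_
    rw [h, sub_self, abs_zero] at hlow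
    linarith
  have hmm : max (F s) (F t) - min (F s) (F t) = |F t - F s| := by
    rw [max_sub_min_eq_abs]
  obtain ⟨p, q, hp, hpq, hq, hhalfF, hisoF⟩ :=
    triangleWave.exists_isometric_subinterval hne (by rwa [hmm])
  have hivt : ∀ y, min (F s) (F t) ≤ y → y ≤ max (F s) (F t) →
      ∃ c ∈ Icc a b, F (c : ℝ) = y := by
    intro y h1 h2
    obtain ⟨x, hx, rfl⟩ := intermediate_value_uIcc hFc.continuousOn
      (show y ∈ uIcc (F s) (F t) from ⟨h1, h2⟩)
    rw [uIcc_of_le hst] at hx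
    have hax := has.trans hx.1
    have hxb := hx.2.trans htb
    exact ⟨⟨x, a.2.1.trans hax, hxb.trans b.2.2⟩, ⟨hax, hxb⟩, rfl⟩
  obtain ⟨c, hc, rfl⟩ := hivt p hp (hpq.trans hq)
  obtain ⟨d, hd, rfl⟩ := hivt q (hp.trans hpq) hq
  refine ⟨c, hc, d, hd, ?_⟩
  change _ ≤ |triangleWave (F d) - triangleWave (F c)|
  rw [hisoF]
  linarith

lemma foldedWave_cover {G : ℝ → ℝ} {L : NNReal} (hG : LipschitzWith L G) {r M : ℝ}
    (hM : 0 < M) (hLM : 2 * L ≤ r * M) {g : C(unitI, unitI)}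
    (hGg : ∀ x : unitI, |G x - g x| ≤ r)
    (a b x : unitI) (hax : a ≤ x) (hxb : x ≤ b) (hlen : (b : ℝ) - a = 2 * (1 / M)) :
    closedBall (g x) (2 * r) ⊆ foldedWave G hG.continuous (4 * r) M '' Icc a b := by
  intro y hy
  rw [mem_closedBall, Subtype.dist_eq, Real.dist_eq] at hy
  have hax' : (a : ℝ) ≤ x := hax
  have hxb' : (x : ℝ) ≤ b := hxb
  have hlenM : M * b - M * a = 2 := by
    rw [← mul_sub, hlen]
    field_simp
  set F : ℝ → ℝ := fun x => G x + 4 * r * (2 * triangleWave (M * x + 1 / 2) - 1) with hF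
  have hFc : Continuous F := by
    have := triangleWave.continuous
    have := hG.continuous
    fun_prop
  have hn0 := Int.le_ceil (M * a + 1 / 2)
  have hn1 := Int.ceil_lt_add_one (M * a + 1 / 2)
  set n := ⌈M * a + 1 / 2⌉
  obtain ⟨s, hs⟩ : ∃ s, (n : ℝ) = M * s + 1 / 2 := ⟨(n - 1 / 2) / M, by field_simp; ring⟩
  obtain ⟨t, ht⟩ : ∃ t, (n : ℝ) + 1 = M * t + 1 / 2 := ⟨(n + 1 / 2) / M, by field_simp; ring⟩
  have has : (a : ℝ) ≤ s := le_of_mul_le_mul_left (by linarith) hM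
  have hst : s ≤ t := le_of_mul_le_mul_left (by linarith) hM
  have htb : t ≤ b := le_of_mul_le_mul_left (by linarith) hM
  have hGx : ∀ z : ℝ, (a : ℝ) ≤ z → z ≤ b → |G z - y| ≤ 4 * r := by
    intro z haz hzb
    have h1 := hG.dist_le_mul z x
    rw [Real.dist_eq, Real.dist_eq] at h1
    have h2 : |z - x| ≤ 2 * (1 / M) := by
      rw [abs_le]; constructor <;> linarith
    have h3 : L * (2 * (1 / M)) ≤ r := by
      rw [← mul_assoc, mul_one_div, div_le_iff₀ hM]
      linarith
    have h4 : (L : ℝ) * |z - x| ≤ r := (mul_le_mul_of_nonneg_left h2 L.2).trans h3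
    have h5 := abs_le.1 (h1.trans h4)
    have h6 := abs_le.1 (hGg x)
    have h7 := abs_le.1 hy
    rw [abs_le]
    constructor <;> linarith [h5.1, h5.2, h6.1, h6.2, h7.1, h7.2]
  have hs' := abs_le.1 (hGx s has (hst.trans htb))
  have ht' := abs_le.1 (hGx t (has.trans hst) htb)
  have hmem : (y : ℝ) ∈ uIcc (F s) (F t) := by
    simp only [hF, ← hs, ← ht, mem_uIcc]
    rcases triangleWave.int_values n with ⟨h0, h1⟩ | ⟨h0, h1⟩ <;> rw [h0, h1]
    · left; constructor <;> linarith [hs'.1, hs'.2, ht'.1, ht'.2]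
    · right; constructor <;> linarith [hs'.1, hs'.2, ht'.1, ht'.2]
  obtain ⟨z, hz, hzy⟩ := intermediate_value_uIcc hFc.continuousOn hmem
  rw [uIcc_of_le hst] at hz
  have haz := has.trans hz.1
  have hzb := hz.2.trans htb
  refine ⟨⟨z, a.2.1.trans haz, hzb.trans b.2.2⟩, ⟨haz, hzb⟩, Subtype.ext ?_⟩
  change triangleWave (F z) = y
  rw [hzy, triangleWave.eq_self y.2.1 y.2.2]

lemma Set.Finite.exists_lipschitzOnWith {s : Set ℝ} (hs : s.Finite) (f : ℝ → ℝ) :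
    ∃ K, LipschitzOnWith K f s := by
  refine LocallyLipschitzOn.exists_lipschitzOnWith_of_compact hs.isCompact fun x hx => ?_
  refine ⟨0, {x}, ?_, by simp [LipschitzOnWith]⟩
  have h := (hs.subset sdiff_subset : (s \ {x}).Finite).isClosed.isOpen_compl.mem_nhds
    (show x ∈ (s \ {x})ᶜ by simp)
  refine mem_nhdsWithin_iff_exists_mem_nhds_inter.2 ⟨_, h, fun y hy => ?_⟩
  by_contra hne
  exact hy.1 ⟨hy.2, hne⟩

/-- A continuous self-map of the interval has Lipschitz approximations with prescribed values
on a finite set. -/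
lemma exists_lipschitz_near_eqOn (g : C(unitI, unitI)) {r : ℝ} (hr : 0 < r) {S : Set ℝ}
    (hS : S.Finite) (hSI : S ⊆ Icc 0 1) (v : ℝ → ℝ)
    (hv : ∀ s : unitI, (s : ℝ) ∈ S → |v s - g s| ≤ r / 2) :
    ∃ (L : NNReal) (G : ℝ → ℝ), LipschitzWith L G ∧ (∀ x : unitI, |G x - g x| ≤ r) ∧
      EqOn G v S := by
  obtain ⟨p, hp⟩ := exists_polynomial_near_of_continuousOn 0 1
    (IccExtend zero_le_one fun x => (g x : ℝ)) (Continuous.continuousOn (by fun_prop))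
    (r / 4) (by linarith)
  have hp' : ∀ x : unitI, |p.eval (x : ℝ) - g x| < r / 4 := fun x => by
    simpa [IccExtend_val] using hp x x.2
  have hloc : LocallyLipschitz fun x : ℝ => p.eval x :=
    ContDiff.locallyLipschitz (𝕂 := ℝ) (by simpa using p.contDiff_aeval (𝕜 := ℝ) 1)
  obtain ⟨K, hK⟩ := (hloc.locallyLipschitzOn (s := Icc 0 1)).exists_lipschitzOnWith_of_compact
    isCompact_Icc
  obtain ⟨P, hP, hPp⟩ := hK.extend_real
  obtain ⟨K', hK'⟩ := hS.exists_lipschitzOnWith fun x => v x - p.eval x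
  obtain ⟨c, hc, hcv⟩ := hK'.extend_real
  have hclamp := (hc.min_const (3 * r / 4)).max_const (-(3 * r / 4))
  refine ⟨_, _, hP.add hclamp, fun x => ?_, fun s hs => ?_⟩
  · have h1 := abs_lt.1 (hp' x)
    have h2 : P x = p.eval (x : ℝ) := (hPp x.2).symm
    have h3 : max (min (c x) (3 * r / 4)) (-(3 * r / 4)) ≤ 3 * r / 4 :=
      max_le (min_le_right _ _) (by linarith)
    have h4 := le_max_right (min (c x) (3 * r / 4)) (-(3 * r / 4))
    rw [h2, abs_le]
    constructor <;> linarith [h1.1, h1.2]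
  · have h1 := abs_lt.1 (hp' ⟨s, hSI hs⟩)
    have h2 := abs_le.1 (hv ⟨s, hSI hs⟩ hs)
    have h3 : P s = p.eval s := (hPp (hSI hs)).symm
    have h4 : c s = v s - p.eval s := (hcv hs).symm
    simp only at h1 h2 ⊢
    rw [h3, h4, min_eq_left (by linarith [h1.1, h1.2, h2.1, h2.2]),
      max_eq_left (by linarith [h1.1, h1.2, h2.1, h2.2])]
    ring

lemma Rat.exists_common_denominator (S : Finset ℚ) :
    ∃ N : ℕ, 0 < N ∧ ∀ s ∈ S, ∃ k : ℤ, (N : ℝ) * s = k := by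
  refine ⟨∏ s ∈ S, s.den, Finset.prod_pos fun s _ => s.den_pos, fun s hs => ?_⟩
  obtain ⟨m, hm⟩ := Finset.dvd_prod_of_mem (fun s : ℚ => s.den) hs
  refine ⟨m * s.num, ?_⟩
  rw [hm]
  have h : (s.den : ℝ) * s = s.num := by
    exact_mod_cast Rat.den_mul_eq_num s
  push_cast
  rw [← h]
  ring

/-- A map in `CP` can be perturbed inside `CP` so as to take prescribed nearby values at finitely
many rational points. -/
lemma exists_mem_CP_near_eqOn {g : C(unitI, unitI)} (hg : g ∈ CP) {r : ℝ} (hr : 0 < r)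
    (hr16 : r ≤ 1 / 16) (S : Finset ℚ) (hSI : ∀ s ∈ S, (s : ℝ) ∈ Icc (0 : ℝ) 1) (v : ℝ → ℝ)
    (hv01 : ∀ s ∈ S, v s ∈ Icc (0 : ℝ) 1)
    (hv : ∀ s ∈ S, ∀ x : unitI, (x : ℝ) = s → |v s - g x| ≤ r / 2) :
    ∃ h ∈ CP, dist h g ≤ 5 * r ∧ ∀ s ∈ S, ∀ x : unitI, (x : ℝ) = s → (h x : ℝ) = v s := by
  obtain ⟨L, G, hG, hGg, hGv⟩ := exists_lipschitz_near_eqOn g hr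
    (S := (fun q : ℚ => (q : ℝ)) '' S) (S.finite_toSet.image _)
    (by rintro _ ⟨s, hs, rfl⟩; exact hSI s hs) v
    (by rintro x ⟨s, hs, hsx⟩; rw [← hsx]; exact hv s hs x hsx.symm)
  obtain ⟨N, hN, hNS⟩ := Rat.exists_common_denominator S
  obtain ⟨K, hK⟩ := exists_nat_ge (2 * ((L : ℝ) + 8) / r)
  rw [div_le_iff₀ hr] at hK
  have hL : (0 : ℝ) ≤ L := L.2
  have hKM : (K : ℝ) ≤ K * N := le_mul_of_one_le_right K.cast_nonneg (by exact_mod_cast hN)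
  set M : ℝ := K * N with hMdef
  have hrM : 2 * ((L : ℝ) + 8) ≤ r * M := by nlinarith
  have hM0 : 0 < M := by
    by_contra hneg
    nlinarith
  refine ⟨foldedWave G hG.continuous (4 * r) M, ?_, ?_, ?_⟩
  · refine mem_CP_of_expanding_of_covering hg.2 (l := 1 / M) (r := r) (by positivity) ?_
      (by linarith) ?_ (foldedWave_cover hG hM0 (by linarith) hGg)
    · rw [mul_one_div, div_le_iff₀ hM0]
      linarith
    · exact foldedWave_expand hG (by linarith) (by linarith) hM0 (by nlinarith) (by linarith)
  · exact (dist_foldedWave_le _ (by linarith) hr.le hGg).trans (by linarith)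
  · intro s hs x hxs
    obtain ⟨k, hk⟩ := hNS s hs
    have hGs : G x = v s := by rw [hxs]; exact hGv ⟨s, hs, rfl⟩
    rw [foldedWave_apply_of_int (k := K * k), hGs]
    · rw [hxs, hMdef, mul_assoc, hk]
      push_cast
      ring
    · rw [hGs]
      exact hv01 s hs

/-- Comparison of two iterates of the endpoints: `f^[j]` sends both endpoints further towards
the corresponding endpoint than `f^[i]` does. -/
def EndpointComparison (i j : ℕ) (f : C(unitI, unitI)) : Prop :=
  f^[j] 0 < f^[i] 0 ∧ f^[i] 1 < f^[j] 1

lemma EndpointComparison.of_mem_conjClass {i j : ℕ} {f g : C(unitI, unitI)}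
    (hg : g ∈ ConjClass f) (h : EndpointComparison i j g) : EndpointComparison i j f := by
  obtain ⟨ψ, hψ⟩ := hg
  have semi : Semiconj ψ g f := fun x => by simp [hψ]
  have hiter : ∀ n x, ψ (g^[n] x) = f^[n] (ψ x) := fun n => semi.iterate_right n
  obtain ⟨h0, h1⟩ := h
  rcases ψ.continuous.strictMono_of_inj ψ.injective with hm | hm
  · have e0 : ψ 0 = 0 := (hm.orderIsoOfSurjective _ ψ.surjective).map_bot
    have e1 : ψ 1 = 1 := (hm.orderIsoOfSurjective _ ψ.surjective).map_top
    have h0' := hm h0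
    have h1' := hm h1
    rw [hiter, hiter, e0] at h0'
    rw [hiter, hiter, e1] at h1'
    exact ⟨h0', h1'⟩
  · have e0 : ψ 0 = 1 := by
      obtain ⟨z, hz⟩ := ψ.surjective 1
      exact le_antisymm (ψ 0).2.2 (hz ▸ hm.antitone z.2.1)
    have e1 : ψ 1 = 0 := by
      obtain ⟨z, hz⟩ := ψ.surjective 0
      exact le_antisymm (hz ▸ hm.antitone z.2.2) (ψ 1).2.1
    have h0' := hm h0
    have h1' := hm h1
    rw [hiter, hiter, e0] at h0'
    rw [hiter, hiter, e1] at h1'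
    exact ⟨h1', h0'⟩

lemma isOpen_endpointComparison (i j : ℕ) : IsOpen {f | EndpointComparison i j f} := by
  have hc : ∀ (n : ℕ) (x : unitI), Continuous fun f : C(unitI, unitI) => f^[n] x := by
    intro n x
    induction n with
    | zero => exact continuous_const
    | succ n ih =>
      simp only [iterate_succ_apply']
      exact continuous_id.eval ih
  have h0 := isOpen_lt (hc j 0) (hc i 0)
  have h1 := isOpen_lt (hc i 1) (hc j 1)
  exact h0.inter h1

lemma exists_rat_near_notMem (t : unitI) {δ : ℝ} (hδ : 0 < δ) (F : Finset ℚ) :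
    ∃ q : ℚ, q ∉ F ∧ (q : ℝ) ∈ Icc (0 : ℝ) 1 ∧ |(q : ℝ) - t| ≤ δ := by
  have ht0 := t.2.1
  have ht1 := t.2.2
  have hlt : max 0 ((t : ℝ) - δ) < min 1 (t + δ) := by
    rw [max_lt_iff, lt_min_iff, lt_min_iff]
    refine ⟨⟨?_, ?_⟩, ?_, ?_⟩ <;> linarith
  obtain ⟨a, ha, ha'⟩ := exists_rat_btwn hlt
  obtain ⟨b, hab, hb⟩ := exists_rat_btwn ha'
  obtain ⟨q, hq, hqF⟩ := (Ioo_infinite (Rat.cast_lt.1 hab)).exists_notMem_finset F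
  have h1 : (a : ℝ) < q := Rat.cast_lt.2 hq.1
  have h2 : (q : ℝ) < b := Rat.cast_lt.2 hq.2
  rw [max_lt_iff] at ha
  rw [lt_min_iff] at hb
  exact ⟨q, hqF, ⟨by linarith, by linarith⟩, abs_le.2 ⟨by linarith, by linarith⟩⟩

/-- Interleaved rational pseudo-orbits of the two endpoints, without repetitions. -/
lemma exists_injective_pseudoOrbit (g : C(unitI, unitI)) {δ : ℝ} (hδ : 0 < δ) :
    ∃ u : ℕ → ℚ, Injective u ∧ u 0 = 0 ∧ u 1 = 1 ∧ (∀ n, (u n : ℝ) ∈ Icc (0 : ℝ) 1) ∧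
      ∀ n, ∀ x : unitI, (x : ℝ) = u n → |(u (n + 2) : ℝ) - g x| ≤ δ := by
  choose next hnot hmem hnear using fun (F : Finset ℚ) (q : ℚ) =>
    exists_rat_near_notMem (g (projIcc 0 1 zero_le_one (q : ℝ))) hδ F
  let step : ℚ × ℚ × Finset ℚ → ℚ × ℚ × Finset ℚ := fun s =>
    (s.2.1, next s.2.2 s.1, insert (next s.2.2 s.1) s.2.2)
  let state : ℕ → ℚ × ℚ × Finset ℚ := fun n => step^[n] (0, 1, {0, 1})
  have hstate : ∀ n, state (n + 1) = step (state n) := fun n => iterate_succ_apply' step n _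
  let u : ℕ → ℚ := fun n => (state n).1
  have hu1 : ∀ n, u (n + 1) = (state n).2.1 := fun n => by simp only [u, hstate, step]
  have hu2 : ∀ n, u (n + 2) = next (state n).2.2 (u n) := fun n => by
    rw [hu1 (n + 1), hstate]
  have hF : ∀ n, ∀ m ≤ n + 1, u m ∈ (state n).2.2 := by
    intro n
    induction n with
    | zero =>
      intro m hm
      interval_cases m <;> simp [u, state, step]
    | succ n ih =>
      intro m hm
      have hins : (state (n + 1)).2.2 = insert (u (n + 2)) (state n).2.2 := by
        rw [hstate, hu2]
      rw [hins]
      rcases Nat.le_succ_iff.1 hm with h | h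
      · exact Finset.mem_insert_of_mem (ih m h)
      · rw [h]
        exact Finset.mem_insert_self _ _
  have hlt : ∀ m n, m < n → u m ≠ u n := by
    intro m n hmn heq
    rcases n with _ | _ | n
    · omega
    · obtain rfl : m = 0 := by omega
      simp [u, state, step] at heq
    · have h1 := hF n m (by omega)
      rw [heq, hu2] at h1
      exact hnot _ _ h1
  refine ⟨u, fun m n h => ?_, rfl, rfl, ?_, ?_⟩
  · rcases lt_trichotomy m n with hmn | hmn | hmn
    · exact absurd h (hlt m n hmn)
    · exact hmn
    · exact absurd h.symm (hlt n m hmn)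
  · rintro (_ | _ | n)
    · simp [u, state]
    · simp [u, state, step]
    · rw [hu2]
      exact hmem _ _
  · intro n x hx
    have h := hnear (state n).2.2 (u n)
    rwa [← hu2, ← hx, projIcc_val] at h

lemma exists_near_pair {z : ℕ → ℝ × ℝ} (hz : ∀ n, z n ∈ Icc (0 : ℝ) 1 ×ˢ Icc (0 : ℝ) 1) {δ : ℝ}
    (hδ : 0 < δ) : ∃ i j, 0 < i ∧ i < j ∧ dist (z i) (z j) < δ := by
  obtain ⟨_, -, φ, hφ, hlim⟩ := (isCompact_Icc.prod isCompact_Icc).tendsto_subseq hz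
  obtain ⟨N, hN⟩ := Metric.cauchySeq_iff.1 hlim.cauchySeq δ hδ
  exact ⟨φ (N + 1), φ (N + 2), (Nat.succ_pos N).trans_le (hφ.id_le _), hφ (by omega),
    hN _ (by omega) _ (by omega)⟩

/-- Maps in `CP` close to `g` that follow a prescribed perturbation `w` of a pseudo-orbit `u`. -/
lemma exists_mem_CP_following {g : C(unitI, unitI)} (hg : g ∈ CP) {r : ℝ} (hr : 0 < r)
    (hr16 : r ≤ 1 / 16) {u : ℕ → ℚ} (hu : Injective u) (hu01 : ∀ n, (u n : ℝ) ∈ Icc (0 : ℝ) 1)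
    (hug : ∀ n, ∀ x : unitI, (x : ℝ) = u n → |(u (n + 2) : ℝ) - g x| ≤ r / 4)
    {w : ℕ → ℝ} (hw01 : ∀ n, w n ∈ Icc (0 : ℝ) 1) (hwu : ∀ n, |w n - u n| ≤ r / 4) (N : ℕ) :
    ∃ h ∈ CP, dist h g ≤ 5 * r ∧ ∀ n < N, ∀ x : unitI, (x : ℝ) = u n → (h x : ℝ) = w (n + 2) := by
  have hinj : Injective fun n => (u n : ℝ) := Rat.cast_injective.comp hu
  let v : ℝ → ℝ := extend (fun n => (u n : ℝ)) (fun n => w (n + 2)) 0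
  have hv : ∀ n, v (u n) = w (n + 2) := fun n => hinj.extend_apply _ _ n
  obtain ⟨h, hCP, hdist, hval⟩ := exists_mem_CP_near_eqOn hg hr hr16
    ((Finset.range N).image u) (by
      intro s hs
      obtain ⟨n, -, rfl⟩ := Finset.mem_image.1 hs
      exact hu01 n) v (by
      intro s hs
      obtain ⟨n, -, rfl⟩ := Finset.mem_image.1 hs
      rw [hv]
      exact hw01 _) (by
      intro s hs x hx
      obtain ⟨n, -, rfl⟩ := Finset.mem_image.1 hs
      rw [hv]
      linarith [abs_sub_le (w (n + 2)) (u (n + 2)) (g x), hwu (n + 2), hug n x hx])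
  refine ⟨h, hCP, hdist, fun n hn x hx => ?_⟩
  rw [hval (u n) (Finset.mem_image_of_mem u (Finset.mem_range.2 hn)) x hx, hv]

/-- Near every map of `CP` some comparison of iterates of the endpoints takes both outcomes. -/
lemma exists_both_endpointComparisons {g : C(unitI, unitI)} (hg : g ∈ CP) {ε : ℝ} (hε : 0 < ε) :
    ∃ i j, (∃ h ∈ CP, dist h g < ε ∧ EndpointComparison i j h) ∧
      ∃ h ∈ CP, dist h g < ε ∧ EndpointComparison j i h := by
  obtain ⟨r, hr, hr16, hrε⟩ : ∃ r : ℝ, 0 < r ∧ r ≤ 1 / 16 ∧ 5 * r < ε :=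
    ⟨min (1 / 16) (ε / 6), by positivity, min_le_left _ _,
      by linarith [min_le_right (1 / 16) (ε / 6)]⟩
  obtain ⟨u, hu, hu0, hu1, hu01, hug⟩ := exists_injective_pseudoOrbit g
    (δ := r / 4) (by linarith)
  obtain ⟨i, j, hi, hij, hclose⟩ := exists_near_pair
    (z := fun n => ((u (2 * n) : ℝ), (u (2 * n + 1) : ℝ))) (fun n => ⟨hu01 _, hu01 _⟩)
    (δ := r / 8) (by linarith)
  rw [Prod.dist_eq, max_lt_iff, Real.dist_eq, Real.dist_eq] at hclose
  have follow : ∀ a b : ℝ, a ∈ Icc (0 : ℝ) 1 → b ∈ Icc (0 : ℝ) 1 → |a - u (2 * i)| ≤ r / 8 →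
      |b - u (2 * i + 1)| ≤ r / 8 → ∃ h ∈ CP, dist h g < ε ∧
        (h^[i] 0 : ℝ) = u (2 * i) ∧ (h^[j] 0 : ℝ) = a ∧
        (h^[i] 1 : ℝ) = u (2 * i + 1) ∧ (h^[j] 1 : ℝ) = b := by
    intro a b ha hb hau hbu
    let w : ℕ → ℝ := update (update (fun n => (u n : ℝ)) (2 * j) a) (2 * j + 1) b
    have hwa : w (2 * j) = a := by simp [w]
    have hwb : w (2 * j + 1) = b := by simp [w]
    have hwu : ∀ n, n ≠ 2 * j → n ≠ 2 * j + 1 → w n = u n := fun n h1 h2 => by simp [w, h1, h2]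
    have hcases : ∀ n, n = 2 * j ∨ n = 2 * j + 1 ∨ w n = u n := fun n => by
      by_cases h1 : n = 2 * j
      · exact Or.inl h1
      by_cases h2 : n = 2 * j + 1
      · exact Or.inr (Or.inl h2)
      exact Or.inr (Or.inr (hwu n h1 h2))
    obtain ⟨h, hCP, hdist, hval⟩ := exists_mem_CP_following hg hr hr16 hu hu01 hug (w := w)
      (fun n => by
        rcases hcases n with rfl | rfl | hn
        · rwa [hwa]
        · rwa [hwb]
        · rw [hn]; exact hu01 n)
      (fun n => by
        rcases hcases n with rfl | rfl | hn
        · rw [hwa]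
          linarith [abs_sub_le a (u (2 * i)) (u (2 * j))]
        · rw [hwb]
          linarith [abs_sub_le b (u (2 * i + 1)) (u (2 * j + 1))]
        · rw [hn, sub_self, abs_zero]; linarith) (2 * j)
    have orbit : ∀ e < 2, ∀ x : unitI, (x : ℝ) = u e → ∀ k ≤ j, (h^[k] x : ℝ) = w (2 * k + e) := by
      intro e he x hx k
      induction k with
      | zero =>
        intro _
        rw [hwu _ (by omega) (by omega)]
        simpa using hx
      | succ k ih =>
        intro hk
        have hk' := ih (by omega)
        rw [hwu _ (by omega) (by omega)] at hk'
        rw [iterate_succ_apply', hval (2 * k + e) (by omega) _ hk']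
        congr 1
        ring
    have h0 := orbit 0 (by norm_num) 0 (by simp [hu0])
    have h1 := orbit 1 (by norm_num) 1 (by simp [hu1])
    refine ⟨h, hCP, by linarith, ?_, ?_, ?_, ?_⟩
    · rw [h0 i hij.le, hwu _ (by omega) (by omega), add_zero]
    · rw [h0 j le_rfl, add_zero, hwa]
    · rw [h1 i hij.le, hwu _ (by omega) (by omega)]
    · rw [h1 j le_rfl, hwb]
  have interior : ∀ n, 2 ≤ n → (0 : ℝ) < u n ∧ (u n : ℝ) < 1 := by
    intro n hn
    refine ⟨lt_of_le_of_ne (hu01 n).1 fun h => ?_, lt_of_le_of_ne (hu01 n).2 fun h => ?_⟩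
    · have : u 0 = u n := by rw [hu0]; exact_mod_cast h
      have := hu this
      omega
    · have : u n = u 1 := by rw [hu1]; exact_mod_cast h
      have := hu this
      omega
  have below : ∀ n, 2 ≤ n → ∃ a ∈ Icc (0 : ℝ) 1, |a - u n| ≤ r / 8 ∧ a < u n := by
    intro n hn
    obtain ⟨h0, h1⟩ := interior n hn
    have h2 := le_max_left 0 ((u n : ℝ) - r / 8)
    have h3 := le_max_right 0 ((u n : ℝ) - r / 8)
    have h4 : max 0 ((u n : ℝ) - r / 8) < u n := max_lt h0 (by linarith)
    exact ⟨_, ⟨h2, by linarith⟩, abs_le.2 ⟨by linarith, by linarith⟩, h4⟩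
  have above : ∀ n, 2 ≤ n → ∃ a ∈ Icc (0 : ℝ) 1, |a - u n| ≤ r / 8 ∧ u n < a := by
    intro n hn
    obtain ⟨h0, h1⟩ := interior n hn
    have h2 := min_le_left 1 ((u n : ℝ) + r / 8)
    have h3 := min_le_right 1 ((u n : ℝ) + r / 8)
    have h4 : u n < min 1 ((u n : ℝ) + r / 8) := lt_min h1 (by linarith)
    exact ⟨_, ⟨by linarith, h2⟩, abs_le.2 ⟨by linarith, by linarith⟩, h4⟩
  refine ⟨i, j, ?_, ?_⟩
  · obtain ⟨a, ha, hau, hlt⟩ := below (2 * i) (by omega)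
    obtain ⟨b, hb, hbu, hgt⟩ := above (2 * i + 1) (by omega)
    obtain ⟨h, hCP, hdist, e1, e2, e3, e4⟩ := follow a b ha hb hau hbu
    exact ⟨h, hCP, hdist, Subtype.coe_lt_coe.1 (by rwa [e1, e2]),
      Subtype.coe_lt_coe.1 (by rwa [e3, e4])⟩
  · obtain ⟨a, ha, hau, hlt⟩ := above (2 * i) (by omega)
    obtain ⟨b, hb, hbu, hgt⟩ := below (2 * i + 1) (by omega)
    obtain ⟨h, hCP, hdist, e1, e2, e3, e4⟩ := follow a b ha hb hau hbu
    exact ⟨h, hCP, hdist, Subtype.coe_lt_coe.1 (by rwa [e1, e2]),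
      Subtype.coe_lt_coe.1 (by rwa [e3, e4])⟩

/-- For every `f ∈ cl(CP)`, the conjugacy class
`G_f = {ψ⁻¹ ∘ f ∘ ψ : ψ a homeomorphism of I}` is a nowhere dense subset of
`cl(CP)` with the uniform metric. -/
theorem conjClass_nowhereDense_in_closure_CP (f : C(unitI, unitI))
    (hf : f ∈ closure CP) :
    IsNowhereDense
      {g : (closure CP : Set C(unitI, unitI)) | (g : C(unitI, unitI)) ∈ ConjClass f} := by
  rw [IsNowhereDense, eq_empty_iff_forall_notMem]
  intro g₀ hg₀
  obtain ⟨ε, hε, hball⟩ := Metric.isOpen_iff.1 isOpen_interior g₀ hg₀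
  obtain ⟨g, hg, hgg₀⟩ := Metric.mem_closure_iff.1 g₀.2 (ε / 2) (half_pos hε)
  have transfer : ∀ i j, (∃ h ∈ CP, dist h g < ε / 2 ∧ EndpointComparison i j h) →
      EndpointComparison i j f := by
    rintro i j ⟨h, hCP, hdist, hcomp⟩
    have hmem : (⟨h, subset_closure hCP⟩ : (closure CP : Set C(unitI, unitI))) ∈ ball g₀ ε := by
      rw [mem_ball, Subtype.dist_eq]
      have := dist_triangle h g g₀
      rw [dist_comm g] at this
      linarith
    obtain ⟨k, hk, hkf⟩ := mem_closure_iff.1 (interior_subset (hball hmem)) _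
      ((isOpen_endpointComparison i j).preimage continuous_subtype_val) hcomp
    exact EndpointComparison.of_mem_conjClass hkf hk
  obtain ⟨i, j, h₁, h₂⟩ := exists_both_endpointComparisons hg (half_pos hε)
  exact lt_asymm (transfer i j h₁).1 (transfer j i h₂).1
end

section
/- There is a residual subset R of (cl(CP), ρ) such that for every f ∈ R and every integer k ≥ 1: (1) the set Fix(f,k) = {x ∈ I : f^k(x) = x} is a Cantor set (nonempty, compact, perfect, and totally disconnected); (2) the set Per(f,k) = {x ∈ I : f^k(x) = x and f^i(x) ≠ x for 1 ≤ i < k} is a relatively open dense subset of Fix(f,k); (3) the Hausdorff dimension of Fix(f,k) is zero, and consequently the Hausdorff dimension of Per(f) = ⋃_{k≥1} Per(f,k) is zero. -/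
open Set Function Metric

/-- `Fix(f,k) = {x : f^k x = x}`. -/
def FixSet (f : unitI → unitI) (k : ℕ) : Set unitI := {x | f^[k] x = x}

/-- `Per(f,k) = {x : f^k x = x and f^i x ≠ x for 1 ≤ i < k}`. -/
def PerSet (f : unitI → unitI) (k : ℕ) : Set unitI :=
  {x | f^[k] x = x ∧ ∀ i, 1 ≤ i → i < k → f^[i] x ≠ x}

/-- `Per(f) = ⋃_{k ≥ 1} Per(f,k)`. -/
def PerAll (f : unitI → unitI) : Set unitI := ⋃ k ∈ {k : ℕ | 1 ≤ k}, PerSet f k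

theorem sum_clamp_eq (v : ℕ → ℝ) {n m : ℕ} (hm : m < n) {y : ℝ} (h₁ : (m : ℝ) ≤ y)
    (h₂ : y ≤ m + 1) :
    v 0 + ∑ j ∈ Finset.range n, (v (j + 1) - v j) * max 0 (min 1 (y - j)) =
      v m + (y - m) * (v (m + 1) - v m) := by
  induction n with
  | zero => omega
  | succ n ih =>
    rw [Finset.sum_range_succ]
    rcases Nat.lt_succ_iff_lt_or_eq.1 hm with h | rfl
    · have : (m : ℝ) + 1 ≤ n := by exact_mod_cast h
      rw [max_eq_left (min_le_of_right_le (by linarith)), mul_zero, add_zero, ih h]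
    · have : ∀ j ∈ Finset.range m, (v (j + 1) - v j) * max 0 (min 1 (y - j)) = v (j + 1) - v j := by
        intro j hj
        have : (j : ℝ) + 1 ≤ m := by exact_mod_cast Finset.mem_range.1 hj
        rw [min_eq_left (by linarith), max_eq_right zero_le_one, mul_one]
      rw [Finset.sum_congr rfl this, Finset.sum_range_sub, min_eq_right (by linarith),
        max_eq_right (by linarith)]
      ring

theorem exists_piecewise_affine (M : ℕ) (v : ℕ → ℝ) (hv : ∀ m, v m ∈ Icc (0 : ℝ) 1) :
    ∃ g : C(unitI, unitI), ∀ m < M, ∀ x : unitI, (m : ℝ) ≤ M * x → (M : ℝ) * x ≤ m + 1 →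
      (g x : ℝ) = v m + (M * x - m) * (v (m + 1) - v m) := by
  let G : unitI → ℝ := fun x ↦
    v 0 + ∑ j ∈ Finset.range M, (v (j + 1) - v j) * max 0 (min 1 (M * (x : ℝ) - j))
  have hG : Continuous G := by fun_prop
  refine ⟨⟨fun x ↦ projIcc 0 1 zero_le_one (G x), continuous_projIcc.comp hG⟩, ?_⟩
  intro m hm x h₁ h₂
  have h := sum_clamp_eq v hm h₁ h₂
  have hGx : G x = v m + (M * x - m) * (v (m + 1) - v m) := h
  obtain ⟨a0, a1⟩ := hv m
  obtain ⟨b0, b1⟩ := hv (m + 1)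
  have : G x ∈ Icc (0 : ℝ) 1 := by
    rw [hGx]; constructor <;> nlinarith
  simp only [ContinuousMap.coe_mk]
  rw [projIcc_of_mem _ this]
  exact hGx

/-- The `i`-th closed interval of the subdivision of `[0,1]` into `N` equal parts. -/
def gridI (N i : ℕ) : Set unitI := {x | (i : ℝ) ≤ N * x ∧ (N : ℝ) * x ≤ i + 1}

theorem gridI_ordConnected (N i : ℕ) : (gridI N i).OrdConnected := by
  refine ⟨fun x hx y hy z hz ↦ ⟨?_, ?_⟩⟩
  · exact hx.1.trans (mul_le_mul_of_nonneg_left hz.1 N.cast_nonneg)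
  · exact le_trans (mul_le_mul_of_nonneg_left hz.2 N.cast_nonneg) hy.2

/-- The grid point `m / M`. -/
noncomputable def gridPt {M m : ℕ} (h : m ≤ M) : unitI :=
  ⟨m / M, by positivity, div_le_one_of_le₀ (by exact_mod_cast h) (by positivity)⟩

theorem mul_gridPt {M m : ℕ} (hM : 0 < M) (h : m ≤ M) : (M : ℝ) * (gridPt h : unitI) = m := by
  have : (M : ℝ) ≠ 0 := by positivity
  simp only [gridPt]; field_simp

theorem exists_mem_gridI {N : ℕ} (hN : 0 < N) (x : unitI) : ∃ i < N, x ∈ gridI N i := by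
  have hN' : (0 : ℝ) < N := by exact_mod_cast hN
  have hx0 : 0 ≤ (N : ℝ) * x := mul_nonneg hN'.le x.2.1
  rcases eq_or_lt_of_le x.2.2 with h | h
  · refine ⟨N - 1, by omega, ?_⟩
    have : ((N - 1 : ℕ) : ℝ) = N - 1 := by push_cast [Nat.cast_sub hN]; ring
    simp only [gridI, mem_ofPred_eq, this, h]
    constructor <;> linarith
  · refine ⟨⌊(N : ℝ) * x⌋₊, ?_, Nat.floor_le hx0, (Nat.lt_floor_add_one _).le⟩
    rw [Nat.floor_lt hx0]; nlinarith

theorem abs_sub_le_of_mem_gridI {N i : ℕ} (hN : 0 < N) {x y : unitI} (hx : x ∈ gridI N i)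
    (hy : y ∈ gridI N i) : |(x : ℝ) - y| ≤ 1 / N := by
  have hN' : (0 : ℝ) < N := by exact_mod_cast hN
  rw [le_div_iff₀ hN', ← abs_of_pos hN', ← abs_mul, abs_le]
  constructor <;> nlinarith [hx.1, hx.2, hy.1, hy.2]

theorem subset_image_of_forall_le {g : C(unitI, unitI)} {S J : Set unitI} (hJ : J.OrdConnected)
    {u v : unitI} (hu : u ∈ J) (hv : v ∈ J) (h : ∀ y ∈ S, g u ≤ y ∧ y ≤ g v) : S ⊆ g '' J := by
  intro y hy
  obtain ⟨x, hx, rfl⟩ := intermediate_value_uIcc (a := u) (b := v) g.continuous.continuousOn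
    (Icc_subset_uIcc (h y hy))
  exact ⟨x, hJ.uIcc_subset hu hv hx, rfl⟩

theorem exists_isFixedPt_of_subset_image {g : unitI → unitI} (hg : Continuous g) {a b : unitI}
    (hab : a ≤ b) (h : Icc a b ⊆ g '' Icc a b) : ∃ x ∈ Icc a b, g x = x := by
  obtain ⟨c, hc, hca⟩ := h (left_mem_Icc.2 hab)
  obtain ⟨d, hd, hdb⟩ := h (right_mem_Icc.2 hab)
  obtain ⟨x, hx, hfix⟩ := isPreconnected_Icc.intermediate_value₂ (s := Icc a b) hc hd
    hg.continuousOn continuous_id.continuousOn (by simpa [hca] using hc.1)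
    (by simpa [hdb] using hd.2)
  exact ⟨x, hx, hfix⟩

/-- A map expanding on every interval of a grid has finitely many points fixed by `g^k`. -/
theorem finite_fixed_of_expanding {M : ℕ} (hM : 0 < M) {g : unitI → unitI}
    (hg : ∀ m < M, ∀ x ∈ gridI M m, ∀ y ∈ gridI M m, 3 * |(x : ℝ) - y| ≤ |(g x : ℝ) - g y|)
    {k : ℕ} (hk : 1 ≤ k) : {x | g^[k] x = x}.Finite := by
  choose c hc hc' using exists_mem_gridI hM
  let φ : unitI → Fin k → Fin M := fun x t ↦ ⟨c (g^[t] x), hc _⟩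
  refine Set.Finite.of_injOn (f := φ) (t := univ) (fun _ _ ↦ mem_univ _) ?_ finite_univ
  intro x hx y hy hxy
  have key : ∀ t ≤ k, 3 ^ t * |(x : ℝ) - y| ≤ |(g^[t] x : ℝ) - g^[t] y| := by
    intro t
    induction t with
    | zero => simp
    | succ t ih =>
      intro ht
      have h1 := ih (by omega)
      have h2 : c (g^[t] x) = c (g^[t] y) := by
        simpa [φ] using congrFun hxy ⟨t, by omega⟩
      have h3 := hg _ (hc _) _ (hc' (g^[t] x)) _ (h2 ▸ hc' (g^[t] y))
      rw [iterate_succ_apply', iterate_succ_apply', pow_succ]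
      linarith
  have h1 := key k le_rfl
  have hx' : g^[k] x = x := hx
  have hy' : g^[k] y = y := hy
  rw [hx', hy'] at h1
  have h3 : (1 : ℝ) < 3 ^ k := one_lt_pow₀ (by norm_num) (by omega)
  have h4 : |(x : ℝ) - y| = 0 := by nlinarith [abs_nonneg ((x : ℝ) - y)]
  exact Subtype.ext (by linarith [abs_eq_zero.1 h4])

/-- Some iterate of any nondegenerate interval under an expanding map covers a grid interval. -/
theorem exists_iterate_covers_gridI {M : ℕ} (hM : 0 < M) {g : C(unitI, unitI)}
    (hg : ∀ m < M, ∀ x ∈ gridI M m, ∀ y ∈ gridI M m, 3 * |(x : ℝ) - y| ≤ |(g x : ℝ) - g y|)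
    {a b : unitI} (hab : a < b) : ∃ n, ∃ m < M, gridI M m ⊆ g^[n] '' Icc a b := by
  by_contra! H
  have hM' : (0 : ℝ) < M := by exact_mod_cast hM
  have key : ∀ n : ℕ, ∃ c d : unitI, Icc c d ⊆ g^[n] '' Icc a b ∧
      (3 / 2 : ℝ) ^ n * (b - a) ≤ (d : ℝ) - c := by
    intro n
    induction n with
    | zero => exact ⟨a, b, by simp, by simp⟩
    | succ n ih =>
      obtain ⟨c, d, hs, hl⟩ := ih
      -- an interval inside one grid interval with half of the length
      obtain ⟨u, v, m, hm, hu, hv, huv, hsub⟩ : ∃ u v : unitI, ∃ m < M, u ∈ gridI M m ∧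
          v ∈ gridI M m ∧ ((d : ℝ) - c) / 2 ≤ |(u : ℝ) - v| ∧ uIcc u v ⊆ Icc c d := by
        have hpos : 0 < (d : ℝ) - c := lt_of_lt_of_le
          (mul_pos (by positivity) (sub_pos.2 (Subtype.coe_lt_coe.2 hab))) hl
        have hcd : c ≤ d := Subtype.coe_le_coe.1 (by linarith)
        have hc1 : (c : ℝ) < 1 := by linarith [d.2.2]
        have hc0 : 0 ≤ (M : ℝ) * c := mul_nonneg hM'.le c.2.1
        set m := ⌊(M : ℝ) * c⌋₊ with hmdef
        have hmM : m < M := by rw [Nat.floor_lt hc0]; nlinarith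
        have hm1 : (m : ℝ) ≤ M * c := Nat.floor_le hc0
        have hm2 : (M : ℝ) * c < m + 1 := Nat.lt_floor_add_one _
        have hcm : c ∈ gridI M m := ⟨hm1, hm2.le⟩
        rcases le_or_gt ((M : ℝ) * d) (m + 1) with h | h
        · refine ⟨c, d, m, hmM, hcm, ⟨by nlinarith, h⟩, ?_, by rw [uIcc_of_le hcd]⟩
          rw [abs_sub_comm, abs_of_pos hpos]; linarith
        have hd1 : (M : ℝ) * d ≤ M := by nlinarith [d.2.2]
        have hmM' : m + 1 < M := by
          have : ((m + 1 : ℕ) : ℝ) < M := by push_cast; linarith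
          exact_mod_cast this
        let p : unitI := gridPt hmM'.le
        have hp : (M : ℝ) * p = m + 1 := by
          have := mul_gridPt hM hmM'.le; push_cast at this; exact this
        have hcp : (c : ℝ) < p := by nlinarith
        have hpd : (p : ℝ) < d := by nlinarith
        have hcp' : c ≤ p := Subtype.coe_le_coe.1 hcp.le
        have hpd' : p ≤ d := Subtype.coe_le_coe.1 hpd.le
        have hd2 : (M : ℝ) * d < m + 2 := by
          by_contra! h2
          refine H n (m + 1) hmM' (Subset.trans ?_ hs)
          intro x hx
          obtain ⟨hx1, hx2⟩ := hx
          push_cast at hx1 hx2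
          refine ⟨Subtype.coe_le_coe.1 ?_, Subtype.coe_le_coe.1 ?_⟩
          · by_contra! h; nlinarith
          · by_contra! h; nlinarith
        rcases le_total ((p : ℝ) - c) (d - p) with h3 | h3
        · refine ⟨p, d, m + 1, hmM', ?_, ?_, ?_, ?_⟩
          · constructor <;> push_cast <;> linarith
          · constructor <;> push_cast <;> linarith
          · rw [abs_sub_comm, abs_of_pos (by linarith)]; linarith
          · rw [uIcc_of_le hpd']; exact Icc_subset_Icc_left hcp'
        · refine ⟨c, p, m, hmM, hcm, ?_, ?_, ?_⟩
          · constructor <;> linarith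
          · rw [abs_sub_comm, abs_of_pos (by linarith)]; linarith
          · rw [uIcc_of_le hcp']; exact Icc_subset_Icc_right hpd'
      have hexp := hg m hm u hu v hv
      have himg : uIcc (g u) (g v) ⊆ g^[n + 1] '' Icc a b := by
        rw [iterate_succ', image_comp]
        exact (intermediate_value_uIcc g.continuous.continuousOn).trans
          (image_mono (hsub.trans hs))
      have hlen : (3 / 2 : ℝ) ^ (n + 1) * (b - a) ≤ |(g u : ℝ) - g v| := by
        rw [pow_succ]; linarith
      rcases le_total (g u) (g v) with h | h
      · refine ⟨g u, g v, by rwa [uIcc_of_le h] at himg, ?_⟩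
        rwa [abs_sub_comm, abs_of_nonneg (sub_nonneg.2 (Subtype.coe_le_coe.2 h))] at hlen
      · refine ⟨g v, g u, by rwa [uIcc_of_ge h] at himg, ?_⟩
        rwa [abs_of_nonneg (sub_nonneg.2 (Subtype.coe_le_coe.2 h))] at hlen
  have hpos : 0 < (b : ℝ) - a := sub_pos.2 (Subtype.coe_lt_coe.2 hab)
  obtain ⟨n, hn⟩ := pow_unbounded_of_one_lt (1 / ((b : ℝ) - a)) (by norm_num : (1 : ℝ) < 3 / 2)
  obtain ⟨c, d, -, h⟩ := key n
  rw [div_lt_iff₀ hpos] at hn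
  linarith [d.2.2, c.2.1]

/-- An expanding map whose grid intervals communicate has a dense set of periodic points. -/
theorem dense_periodicPts_of_expanding {N M : ℕ} (hN : 0 < N) (hM : 0 < M) {g : C(unitI, unitI)}
    (hg : ∀ m < M, ∀ x ∈ gridI M m, ∀ y ∈ gridI M m, 3 * |(x : ℝ) - y| ≤ |(g x : ℝ) - g y|)
    (hcov : ∀ m < M, ∃ i < N, gridI N i ⊆ g '' gridI M m)
    (hconn : ∀ i < N, ∀ j < N, ∃ n, gridI N j ⊆ g^[n] '' gridI N i) :
    Dense (periodicPts g) := by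
  rw [dense_iff_inter_open]
  intro U hU hne
  have hN' : (0 : ℝ) < N := by exact_mod_cast hN
  obtain ⟨a', b', hab', hsub⟩ := hU.exists_Ioo_subset hne
  obtain ⟨a, ha1, ha2⟩ := exists_between hab'
  obtain ⟨b₀, hb1, hb2⟩ := exists_between ha2
  have ha1' : (a : ℝ) < 1 := lt_of_lt_of_le (Subtype.coe_lt_coe.2 hb1) b₀.2.2
  have ha0 : 0 ≤ (N : ℝ) * a := mul_nonneg hN'.le a.2.1
  set j := ⌊(N : ℝ) * a⌋₊
  have hj : j < N := by rw [Nat.floor_lt ha0]; nlinarith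
  have hj1 : (j : ℝ) ≤ N * a := Nat.floor_le ha0
  have hj2 : (N : ℝ) * a < j + 1 := Nat.lt_floor_add_one _
  let p : unitI := gridPt (Nat.succ_le_of_lt hj)
  have hp : (N : ℝ) * p = j + 1 := by
    have := mul_gridPt hN (Nat.succ_le_of_lt hj); push_cast at this; exact this
  have hap : a < p := Subtype.coe_lt_coe.1 (by nlinarith)
  let b := min b₀ p
  have hab : a < b := lt_min hb1 hap
  have hJ : Icc a b ⊆ gridI N j := by
    have hbp : (b : ℝ) ≤ p := Subtype.coe_le_coe.2 (min_le_right _ _)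
    refine (gridI_ordConnected N j).out ⟨hj1, hj2.le⟩ ⟨?_, ?_⟩
    · have : (a : ℝ) < b := Subtype.coe_lt_coe.2 hab
      nlinarith
    · nlinarith
  obtain ⟨n, m, hm, h1⟩ := exists_iterate_covers_gridI hM hg hab
  obtain ⟨i, hi, h2⟩ := hcov m hm
  obtain ⟨l, h3⟩ := hconn i hi j hj
  have h4 : Icc a b ⊆ g^[l + (1 + n)] '' Icc a b := by
    rw [iterate_add, image_comp, iterate_add, image_comp, iterate_one]
    exact hJ.trans (h3.trans (image_mono (h2.trans (image_mono h1))))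
  obtain ⟨x, hx, hfix⟩ := exists_isFixedPt_of_subset_image (g.continuous.iterate _) hab.le h4
  refine ⟨x, hsub ⟨ha1.trans_le hx.1, (hx.2.trans (min_le_left _ _)).trans_lt hb2⟩, ?_⟩
  exact mk_mem_periodicPts (n := l + (1 + n)) (by omega) hfix

theorem exists_nat_near {N : ℕ} (hN : 2 ≤ N) {y : ℝ} (h0 : 0 ≤ y) (h1 : y ≤ N) :
    ∃ c : ℕ, 1 ≤ c ∧ c + 1 ≤ N ∧ |(c : ℝ) - y| ≤ 1 := by
  have hf1 := Nat.floor_le h0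
  have hf2 := Nat.lt_floor_add_one y
  set n := ⌊y⌋₊
  rcases Nat.eq_zero_or_pos n with h | h
  · refine ⟨1, le_rfl, by omega, ?_⟩
    rw [h] at hf2
    push_cast at *
    rw [abs_le]; constructor <;> linarith
  · rcases lt_or_ge n N with h' | h'
    · refine ⟨n, h, h', ?_⟩
      rw [abs_le]; constructor <;> linarith
    · refine ⟨N - 1, by omega, by omega, ?_⟩
      have : (N : ℝ) ≤ n := by exact_mod_cast h'
      rw [Nat.cast_sub (by omega), abs_le]
      push_cast
      constructor <;> linarith

/-- Approximation of a continuous map by an expanding piecewise affine Markov map whose grid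
intervals have fat images. -/
theorem exists_fat_markov (f : C(unitI, unitI)) {q s N : ℕ} (hq : 1 ≤ q) (hs : 1 ≤ s)
    (hN : N = q * s) (hN2 : 2 ≤ N)
    (hosc : ∀ x y : unitI, |(x : ℝ) - y| ≤ 1 / N → |(f x : ℝ) - f y| ≤ 1 / q) :
    ∃ g : C(unitI, unitI), (∀ x, |(g x : ℝ) - f x| ≤ 6 / q) ∧
      (∀ m < 3 * N, ∀ x ∈ gridI (3 * N) m, ∀ y ∈ gridI (3 * N) m,
        3 * |(x : ℝ) - y| ≤ |(g x : ℝ) - g y|) ∧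
      (∀ m < 3 * N, ∃ i < N, gridI N i ⊆ g '' gridI (3 * N) m) ∧
      (∀ i < N, ∀ l < N, ∀ w ∈ gridI N i, ∀ y ∈ gridI N l, |(f w : ℝ) - y| ≤ 1 / q →
        ∃ u ∈ gridI N i, ∃ v ∈ gridI N i, (N : ℝ) * g u ≤ l ∧ (l : ℝ) + 1 ≤ N * g v) := by
  have hN0 : (0 : ℝ) < N := by exact_mod_cast (by omega : 0 < N)
  have hq0 : (0 : ℝ) < q := by exact_mod_cast hq
  have hs1 : (1 : ℝ) ≤ s := by exact_mod_cast hs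
  have hNq : (N : ℝ) = q * s := by exact_mod_cast hN
  have hscale : ∀ {A B : ℝ}, |A - B| ≤ 1 / q → |N * A - N * B| ≤ s := by
    intro A B h
    rw [← mul_sub, abs_mul, abs_of_pos hN0]
    calc (N : ℝ) * |A - B| ≤ N * (1 / q) := mul_le_mul_of_nonneg_left h hN0.le
      _ = s := by rw [hNq]; field_simp
  have hc : ∀ i : ℕ, ∃ c : ℕ, 1 ≤ c ∧ c + 1 ≤ N ∧
      ∀ x : unitI, (N : ℝ) * x = i → |(c : ℝ) - N * f x| ≤ 1 := by
    intro i
    obtain ⟨c, h1, h2, h3⟩ := exists_nat_near hN2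
      (y := N * f (projIcc 0 1 zero_le_one ((i : ℝ) / N)))
      (mul_nonneg hN0.le (f _).2.1) (mul_le_of_le_one_right hN0.le (f _).2.2)
    refine ⟨c, h1, h2, fun x hx ↦ ?_⟩
    have : (i : ℝ) / N = x := by rw [← hx]; field_simp
    rwa [this, projIcc_val] at h3
  choose c hc1 hc2 hc3 using hc
  have hnear : ∀ i < N, ∀ x ∈ gridI N i, |(c i : ℝ) - N * f x| ≤ s + 1 := by
    intro i hi x hx
    have hp := mul_gridPt (by omega) hi.le
    have h1 := hc3 i (gridPt hi.le) hp
    have h2 : gridPt hi.le ∈ gridI N i := ⟨hp.ge, by linarith⟩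
    have h3 := hscale (hosc _ _ (abs_sub_le_of_mem_gridI (by omega) h2 hx))
    rw [abs_le] at *
    constructor <;> linarith
  have hadj : ∀ i < N, c (i + 1) ≤ c i + s + 2 ∧ c i ≤ c (i + 1) + s + 2 := by
    intro i hi
    have hp := mul_gridPt (by omega) (Nat.succ_le_of_lt hi)
    have h1 := hc3 (i + 1) (gridPt (Nat.succ_le_of_lt hi)) hp
    have h2 := hnear i hi (gridPt (Nat.succ_le_of_lt hi)) (by
      push_cast at hp; constructor <;> linarith)
    rw [abs_le] at h1 h2
    constructor
    · have : (c (i + 1) : ℝ) ≤ c i + s + 2 := by linarith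
      exact_mod_cast this
    · have : (c i : ℝ) ≤ c (i + 1) + s + 2 := by linarith
      exact_mod_cast this
  let V : ℕ → ℕ := fun m ↦ if m % 3 = 0 then c (m / 3) else
    if m % 3 = 1 then min N (c (m / 3) + 4 * s) else c (m / 3) - 4 * s
  have hV0 : ∀ i, V (3 * i) = c i := fun i ↦ by simp [V]
  have hV1 : ∀ i, V (3 * i + 1) = min N (c i + 4 * s) := fun i ↦ by
    simp [V, Nat.add_mod, (by omega : (3 * i + 1) / 3 = i)]
  have hV2 : ∀ i, V (3 * i + 2) = c i - 4 * s := fun i ↦ by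
    simp [V, Nat.add_mod, (by omega : (3 * i + 2) / 3 = i)]
  have hV3 : ∀ i, V (3 * i + 3) = c (i + 1) := fun i ↦ hV0 (i + 1)
  have hdecomp : ∀ m, ∃ i, m = 3 * i ∨ m = 3 * i + 1 ∨ m = 3 * i + 2 := fun m ↦
    ⟨m / 3, by omega⟩
  have hVN : ∀ m, V m ≤ N := by
    intro m
    obtain ⟨i, rfl | rfl | rfl⟩ := hdecomp m <;> have := hc2 i <;>
      simp only [hV0, hV1, hV2] <;> omega
  have hV : ∀ i < N, ∀ m, (m = 3 * i ∨ m = 3 * i + 1 ∨ m = 3 * i + 2) →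
      V m ≠ V (m + 1) ∧ c i ≤ V m + 4 * s ∧ c i ≤ V (m + 1) + 4 * s ∧
        V m ≤ c i + 4 * s ∧ V (m + 1) ≤ c i + 4 * s := by
    intro i hi m hm
    have h1 := hc1 i
    have h2 := hc2 i
    have h3 := hc1 (i + 1)
    have h4 := hc2 (i + 1)
    have h5 := hadj i hi
    rcases hm with rfl | rfl | rfl <;> simp only [hV0, hV1, hV2, hV3] <;> omega
  obtain ⟨g, hg⟩ := exists_piecewise_affine (3 * N) (fun m ↦ (V m : ℝ) / N) (fun m ↦
    ⟨by positivity, div_le_one_of_le₀ (by exact_mod_cast hVN m) hN0.le⟩)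
  have hgN : ∀ m < 3 * N, ∀ x ∈ gridI (3 * N) m,
      (N : ℝ) * g x = V m + (3 * N * x - m) * ((V (m + 1) : ℝ) - V m) := by
    intro m hm x hx
    rw [hg m hm x hx.1 hx.2]
    push_cast
    field_simp
  have hnode : ∀ m < 3 * N, ∀ h : m ≤ 3 * N,
      gridPt h ∈ gridI (3 * N) m ∧ (N : ℝ) * g (gridPt h) = V m := by
    intro m hm h
    have hp := mul_gridPt (by omega) h
    have h2 : gridPt h ∈ gridI (3 * N) m := ⟨hp.ge, by linarith⟩
    refine ⟨h2, ?_⟩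
    push_cast at hp
    rw [hgN m hm _ h2, hp]; ring
  have hnode' : ∀ m < 3 * N, ∀ h : m + 1 ≤ 3 * N,
      gridPt h ∈ gridI (3 * N) m ∧ (N : ℝ) * g (gridPt h) = V (m + 1) := by
    intro m hm h
    have hp := mul_gridPt (by omega) h
    have h2 : gridPt h ∈ gridI (3 * N) m := by
      push_cast at hp; constructor <;> push_cast <;> linarith
    refine ⟨h2, ?_⟩
    push_cast at hp
    rw [hgN m hm _ h2, hp]; ring
  have hsub : ∀ i m, (m = 3 * i ∨ m = 3 * i + 1 ∨ m = 3 * i + 2) →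
      gridI (3 * N) m ⊆ gridI N i := by
    rintro i m hm x ⟨h1, h2⟩
    push_cast at h1 h2
    rcases hm with rfl | rfl | rfl <;> push_cast at h1 h2 <;> constructor <;> linarith
  refine ⟨g, ?_, ?_, ?_, ?_⟩
  · intro x
    obtain ⟨m, hm, hx⟩ := exists_mem_gridI (by omega : 0 < 3 * N) x
    obtain ⟨i, hmi⟩ := hdecomp m
    have hi : i < N := by omega
    have h1 := hnear i hi x (hsub i m hmi hx)
    obtain ⟨-, h2, h3, h4, h5⟩ := hV i hi m hmi
    have h2' : (c i : ℝ) ≤ V m + 4 * s := by exact_mod_cast h2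
    have h3' : (c i : ℝ) ≤ V (m + 1) + 4 * s := by exact_mod_cast h3
    have h4' : (V m : ℝ) ≤ c i + 4 * s := by exact_mod_cast h4
    have h5' : (V (m + 1) : ℝ) ≤ c i + 4 * s := by exact_mod_cast h5
    have h6 := hgN m hm x hx
    obtain ⟨t0, t1⟩ := hx
    push_cast at t0 t1
    have h7 : (c i : ℝ) - 4 * s ≤ N * g x := by rw [h6]; nlinarith
    have h8 : (N : ℝ) * g x ≤ c i + 4 * s := by rw [h6]; nlinarith
    have h9 : N * |(g x : ℝ) - f x| ≤ 6 * s := by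
      rw [← abs_of_pos hN0, ← abs_mul, abs_le]
      rw [abs_le] at h1
      constructor <;> linarith
    rw [le_div_iff₀ hq0]
    rw [hNq] at h9
    nlinarith
  · intro m hm x hx y hy
    obtain ⟨i, hmi⟩ := hdecomp m
    have hne := (hV i (by omega) m hmi).1
    have h1 : (1 : ℝ) ≤ |(V (m + 1) : ℝ) - V m| := by
      have : (1 : ℤ) ≤ |(V (m + 1) : ℤ) - V m| := Int.one_le_abs (by omega)
      exact_mod_cast this
    have h2 : (N : ℝ) * ((g x : ℝ) - g y) =
        (3 * N * ((x : ℝ) - y)) * ((V (m + 1) : ℝ) - V m) := by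
      rw [mul_sub, hgN m hm x hx, hgN m hm y hy]; ring
    have h3 : (N : ℝ) * |(g x : ℝ) - g y| =
        N * (3 * |(x : ℝ) - y| * |(V (m + 1) : ℝ) - V m|) := by
      have := congrArg abs h2
      rw [abs_mul, abs_mul, abs_mul, abs_mul, abs_of_pos hN0, abs_of_pos (by norm_num : (0:ℝ) < 3)]
        at this
      rw [this]; ring
    rw [mul_left_cancel₀ hN0.ne' h3]
    exact le_mul_of_one_le_right (by positivity) h1
  · intro m hm
    obtain ⟨i, hmi⟩ := hdecomp m
    have hne := (hV i (by omega) m hmi).1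
    have hb1 := hVN m
    have hb2 := hVN (m + 1)
    obtain ⟨hu, hgu⟩ := hnode m hm hm.le
    obtain ⟨hv, hgv⟩ := hnode' m hm hm
    have hle : ∀ {a b : ℝ}, (N : ℝ) * a ≤ N * b → a ≤ b := fun h ↦ le_of_mul_le_mul_left h hN0
    rcases lt_or_gt_of_ne hne with h | h
    · have h' : (V m : ℝ) + 1 ≤ V (m + 1) := by exact_mod_cast h
      refine ⟨V m, by omega, subset_image_of_forall_le (gridI_ordConnected _ _) hu hv ?_⟩
      intro y hy
      exact ⟨Subtype.coe_le_coe.1 (hle (hgu.trans_le hy.1)),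
        Subtype.coe_le_coe.1 (hle (hy.2.trans (h'.trans hgv.ge)))⟩
    · have h' : (V (m + 1) : ℝ) + 1 ≤ V m := by exact_mod_cast h
      refine ⟨V (m + 1), by omega, subset_image_of_forall_le (gridI_ordConnected _ _) hv hu ?_⟩
      intro y hy
      exact ⟨Subtype.coe_le_coe.1 (hle (hgv.trans_le hy.1)),
        Subtype.coe_le_coe.1 (hle (hy.2.trans (h'.trans hgu.ge)))⟩
  · intro i hi l hl w hw y hy hfy
    obtain ⟨hu, hgu⟩ := hnode (3 * i + 2) (by omega) (by omega)
    obtain ⟨hv, hgv⟩ := hnode (3 * i + 1) (by omega) (by omega)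
    refine ⟨_, hsub i _ (by omega) hu, _, hsub i _ (by omega) hv, ?_, ?_⟩
    all_goals
      have h1 := hnear i hi w hw
      have h2 := hscale hfy
      obtain ⟨h3, h4⟩ := hy
      rw [abs_le] at h1 h2
    · rw [hgu, hV2]
      have : (c i : ℝ) ≤ l + 4 * s := by linarith
      have : c i ≤ l + 4 * s := by exact_mod_cast this
      have : c i - 4 * s ≤ l := by omega
      exact_mod_cast this
    · rw [hgv, hV1]
      have : (l : ℝ) + 1 ≤ c i + 4 * s := by linarith
      have : l + 1 ≤ c i + 4 * s := by exact_mod_cast this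
      have : l + 1 ≤ min N (c i + 4 * s) := le_min hl this
      exact_mod_cast this

theorem gridI_eq_Icc {N i : ℕ} (hi : i < N) :
    gridI N i = Icc (gridPt hi.le) (gridPt (Nat.succ_le_of_lt hi)) := by
  have hN0 : (0 : ℝ) < N := by exact_mod_cast (by omega : 0 < N)
  have h1 := mul_gridPt (by omega) hi.le
  have h2 := mul_gridPt (by omega) (Nat.succ_le_of_lt hi)
  push_cast at h2
  ext x
  rw [mem_Icc, ← Subtype.coe_le_coe, ← Subtype.coe_le_coe, ← mul_le_mul_iff_right₀ hN0, h1,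
    ← mul_le_mul_iff_right₀ hN0 (b := (x : ℝ)), h2]
  rfl

theorem gridPt_lt_gridPt {N i : ℕ} (hi : i < N) :
    gridPt hi.le < gridPt (Nat.succ_le_of_lt hi) := by
  have hN0 : (0 : ℝ) < N := by exact_mod_cast (by omega : 0 < N)
  have h1 := mul_gridPt (by omega) hi.le
  have h2 := mul_gridPt (by omega) (Nat.succ_le_of_lt hi)
  push_cast at h2
  exact Subtype.coe_lt_coe.1 (by nlinarith)

theorem le_add_one_of_mem_gridI {N i j : ℕ} {x : unitI} (hi : x ∈ gridI N i)
    (hj : x ∈ gridI N j) : i ≤ j + 1 := by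
  exact_mod_cast hi.1.trans hj.2

/-- If the periodic points of `f` are dense and `g` has fat images compared to `f`, then all grid
intervals communicate under `g`. -/
theorem gridI_reachable {f : C(unitI, unitI)} (hf : Dense (periodicPts f)) {N : ℕ}
    {g : unitI → unitI} {δ : ℝ} (hδ : 0 < δ)
    (hfat : ∀ i < N, ∀ l < N, ∀ w ∈ gridI N i, ∀ y ∈ gridI N l, |(f w : ℝ) - y| ≤ δ →
      gridI N l ⊆ g '' gridI N i) :
    ∀ i < N, ∀ j < N, ∃ n, gridI N j ⊆ g^[n] '' gridI N i := by
  intro i hi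
  have hN : 0 < N := by omega
  let D : ℕ → Prop := fun j ↦ ∃ n, gridI N j ⊆ g^[n] '' gridI N i
  have hclosed : ∀ j < N, D j → ∀ l < N, ∀ w ∈ gridI N j, ∀ y ∈ gridI N l,
      |(f w : ℝ) - y| ≤ δ → D l := by
    rintro j hj ⟨n, hn⟩ l hl w hw y hy hwy
    refine ⟨n + 1, ?_⟩
    rw [iterate_succ', image_comp]
    exact (hfat j hj l hl w hw y hy hwy).trans (image_mono hn)
  have hnbr : ∀ j < N, D j → ∀ j' < N, (gridI N j ∩ gridI N j').Nonempty → D j' := by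
    rintro j hj hD j' hj' ⟨p, hpj, hpj'⟩
    have hW : IsOpen {z : unitI | |(f p : ℝ) - f z| < δ} :=
      isOpen_lt (by fun_prop) continuous_const
    have hcl : p ∈ closure (Ioo (gridPt hj'.le) (gridPt (Nat.succ_le_of_lt hj'))) := by
      rwa [closure_Ioo (gridPt_lt_gridPt hj').ne, ← gridI_eq_Icc hj']
    have hne := mem_closure_iff.1 hcl _ hW (by simpa using hδ)
    obtain ⟨z, ⟨hzW, hzU⟩, hzper⟩ := hf.inter_open_nonempty _ (hW.inter isOpen_Ioo) hne
    have hzj' : z ∈ gridI N j' := by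
      rw [gridI_eq_Icc hj']; exact Ioo_subset_Icc_self hzU
    obtain ⟨n, hn0, hn⟩ := hzper
    have key : ∀ t, ∀ l < N, f^[t + 1] z ∈ gridI N l → D l := by
      intro t
      induction t with
      | zero =>
        intro l hl hz
        exact hclosed j hj hD l hl p hpj _ hz (le_of_lt hzW)
      | succ t ih =>
        intro l hl hz
        obtain ⟨l', hl', hz'⟩ := exists_mem_gridI hN (f^[t + 1] z)
        refine hclosed l' hl' (ih l' hl' hz') l hl _ hz' _ hz ?_
        rw [iterate_succ_apply' (⇑f) (t + 1) z, sub_self, abs_zero]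
        exact hδ.le
    refine key (n - 1) j' hj' ?_
    rwa [Nat.sub_add_cancel hn0, hn]
  have hD0 : D i := ⟨0, by simp⟩
  have hmeet : ∀ j, j + 1 < N → (gridI N j ∩ gridI N (j + 1)).Nonempty := by
    intro j hj
    have h := mul_gridPt hN hj.le
    push_cast at h
    refine ⟨gridPt hj.le, ⟨by linarith, h.le⟩, ⟨by push_cast; exact h.ge, by push_cast; linarith⟩⟩
  have hup : ∀ d, i + d < N → D (i + d) := by
    intro d
    induction d with
    | zero => exact fun _ ↦ hD0
    | succ d ih =>
      intro h
      exact hnbr _ (by omega) (ih (by omega)) _ h (hmeet _ h)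
  have hdown : ∀ d ≤ i, D (i - d) := by
    intro d
    induction d with
    | zero => exact fun _ ↦ hD0
    | succ d ih =>
      intro h
      refine hnbr _ (by omega) (ih (by omega)) _ (by omega) ?_
      have := hmeet (i - (d + 1)) (by omega)
      rwa [show i - (d + 1) + 1 = i - d by omega, inter_comm] at this
  intro j hj
  rcases le_total i j with h | h
  · have := hup (j - i) (by omega)
    rwa [Nat.add_sub_cancel' h] at this
  · have := hdown (i - j) (by omega)
    rwa [Nat.sub_sub_self h] at this

/-- A continuous function taking the values `l ≤ r` at the endpoints of an interval maps a
subinterval exactly into `[l, r]`, with endpoints going to `l` and `r`. -/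
theorem exists_subinterval_mapsTo {α β : Type*} [ConditionallyCompleteLinearOrder α]
    [TopologicalSpace α] [OrderTopology α] [DenselyOrdered α] [LinearOrder β]
    [TopologicalSpace β] [OrderClosedTopology β] {φ : α → β} (hφ : Continuous φ) {u v : α}
    (huv : u ≤ v) (hle : φ u ≤ φ v) :
    ∃ a ∈ Icc u v, ∃ b ∈ Icc u v, a ≤ b ∧ φ a = φ u ∧ φ b = φ v ∧
      ∀ x ∈ Icc a b, φ x ∈ Icc (φ u) (φ v) := by
  obtain ⟨a, ⟨ha, haφ⟩, hamax⟩ := (isCompact_Icc.inter_right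
    (isClosed_singleton.preimage hφ : IsClosed (φ ⁻¹' {φ u}))).exists_isGreatest
      ⟨u, left_mem_Icc.2 huv, rfl⟩
  obtain ⟨b, ⟨hb, hbφ⟩, hbmin⟩ := (isCompact_Icc.inter_right
    (isClosed_singleton.preimage hφ : IsClosed (φ ⁻¹' {φ v}))).exists_isLeast
      ⟨v, right_mem_Icc.2 ha.2, rfl⟩
  have haφ' : φ a = φ u := haφ
  have hbφ' : φ b = φ v := hbφ
  refine ⟨a, ha, b, ⟨ha.1.trans hb.1, hb.2⟩, hb.1, haφ', hbφ', ?_⟩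
  intro x hx
  constructor
  · by_contra! h
    obtain ⟨y, hy, hyφ⟩ := intermediate_value_Icc (hx.2.trans hb.2) hφ.continuousOn ⟨h.le, hle⟩
    have hya : y ≤ a := hamax ⟨⟨ha.1.trans (hx.1.trans hy.1), hy.2⟩, hyφ⟩
    have hxa : x = a := le_antisymm (hy.1.trans hya) hx.1
    exact h.ne (hxa ▸ haφ')
  · by_contra! h
    obtain ⟨y, hy, hyφ⟩ := intermediate_value_Icc hx.1 hφ.continuousOn ⟨haφ'.trans_le hle, h.le⟩
    have hby : b ≤ y := hbmin ⟨⟨hy.1, hy.2.trans (hx.2.trans hb.2)⟩, hyφ⟩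
    have hxb : x = b := le_antisymm hx.2 (hby.trans hy.2)
    exact h.ne' (hxb ▸ hbφ')

theorem exists_uIcc_mapsTo {φ : unitI → unitI} (hφ : Continuous φ) {u v : unitI}
    (hle : φ u ≤ φ v) :
    ∃ a ∈ uIcc u v, ∃ b ∈ uIcc u v, φ a = φ u ∧ φ b = φ v ∧
      ∀ x ∈ uIcc a b, φ x ∈ Icc (φ u) (φ v) := by
  rcases le_total u v with h | h
  · obtain ⟨a, ha, b, hb, hab, h1, h2, h3⟩ := exists_subinterval_mapsTo hφ h hle
    rw [uIcc_of_le h]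
    exact ⟨a, ha, b, hb, h1, h2, by rwa [uIcc_of_le hab]⟩
  · obtain ⟨a, ha, b, hb, hab, h1, h2, h3⟩ := exists_subinterval_mapsTo (β := unitIᵒᵈ)
      (φ := OrderDual.toDual ∘ φ) (continuous_toDual.comp hφ) h hle
    rw [uIcc_of_ge h]
    refine ⟨b, hb, a, ha, h2, h1, ?_⟩
    rw [uIcc_of_ge hab]
    exact fun x hx ↦ ⟨(h3 x hx).2, (h3 x hx).1⟩

/-- A cyclic chain of intervals covering each other carries a periodic orbit. -/
theorem exists_periodic_of_covering {h : unitI → unitI} (hh : Continuous h) (l r : ℕ → unitI)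
    (hlr : ∀ t, l t ≤ r t)
    (hcov : ∀ t, Icc (l (t + 1)) (r (t + 1)) ⊆ h '' Icc (l t) (r t)) {k : ℕ} (hl : l k = l 0)
    (hr : r k = r 0) : ∃ x, h^[k] x = x ∧ ∀ t ≤ k, h^[t] x ∈ Icc (l t) (r t) := by
  have key : ∀ t, ∃ a b : unitI, h^[t] a = l t ∧ h^[t] b = r t ∧
      ∀ x ∈ uIcc a b, ∀ i ≤ t, h^[i] x ∈ Icc (l i) (r i) := by
    intro t
    induction t with
    | zero =>
      refine ⟨l 0, r 0, rfl, rfl, fun x hx i hi ↦ ?_⟩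
      obtain rfl : i = 0 := by omega
      rwa [uIcc_of_le (hlr 0)] at hx
    | succ t ih =>
      obtain ⟨a, b, ha, hb, hab⟩ := ih
      have hpull : ∀ y ∈ Icc (l (t + 1)) (r (t + 1)), ∃ x ∈ uIcc a b, h^[t + 1] x = y := by
        intro y hy
        obtain ⟨z, hz, rfl⟩ := hcov t hy
        rw [← ha, ← hb] at hz
        obtain ⟨x, hx, rfl⟩ := intermediate_value_uIcc (hh.iterate t).continuousOn
          (Icc_subset_uIcc hz)
        exact ⟨x, hx, iterate_succ_apply' _ _ _⟩
      obtain ⟨u, hu, hul⟩ := hpull _ (left_mem_Icc.2 (hlr _))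
      obtain ⟨v, hv, hvr⟩ := hpull _ (right_mem_Icc.2 (hlr _))
      obtain ⟨a', ha', b', hb', h1, h2, h3⟩ := exists_uIcc_mapsTo (hh.iterate (t + 1))
        (u := u) (v := v) (by rw [hul, hvr]; exact hlr _)
      rw [hul] at h1 h3
      rw [hvr] at h2 h3
      refine ⟨a', b', h1, h2, fun x hx i hi ↦ ?_⟩
      rcases Nat.le_succ_iff.1 hi with hi | rfl
      · exact hab x (uIcc_subset_uIcc hu hv (uIcc_subset_uIcc ha' hb' hx)) i hi
      · exact h3 x hx
  obtain ⟨a, b, ha, hb, hab⟩ := key k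
  have ha0 := hab a left_mem_uIcc 0 (Nat.zero_le _)
  have hb0 := hab b right_mem_uIcc 0 (Nat.zero_le _)
  obtain ⟨x, hx, hfix⟩ := (isPreconnected_uIcc (a := a) (b := b)).intermediate_value₂
    left_mem_uIcc right_mem_uIcc (hh.iterate k).continuousOn continuous_id.continuousOn
    (by rw [ha, hl]; exact ha0.1) (by rw [hb, hr]; exact hb0.2)
  exact ⟨x, hfix, hab x hx⟩

theorem gridI_mul_subset {Q B u ρ : ℕ} (hρ : ρ < B) :
    gridI (Q * B) (B * u + ρ) ⊆ gridI Q u := by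
  rintro x ⟨h1, h2⟩
  have hB : (0 : ℝ) < B := by exact_mod_cast (by omega : 0 < B)
  have hρ' : (ρ : ℝ) + 1 ≤ B := by exact_mod_cast hρ
  have hρ0 : (0 : ℝ) ≤ ρ := by positivity
  push_cast at h1 h2
  constructor
  · by_contra! h; nlinarith
  · by_contra! h; nlinarith

/-- Near every point fixed by `f^k`, maps close to a fat approximation of `f` have points of exact
period `k`, in each of two disjoint intervals (`c = 0` and `c = 1`). -/
theorem exists_mem_perSet_near {f g h : C(unitI, unitI)} {Q k N : ℕ} {δ : ℝ} (hk : 1 ≤ k)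
    (hQ : 0 < Q) (hN : N = Q * (4 * k + 1)) (hδ : 1 / (Q : ℝ) ≤ δ / 2)
    (hosc : ∀ x y : unitI, |(x : ℝ) - y| ≤ 1 / Q → |(f x : ℝ) - f y| ≤ δ / 2)
    (hfat : ∀ i < N, ∀ l < N, ∀ w ∈ gridI N i, ∀ y ∈ gridI N l, |(f w : ℝ) - y| ≤ δ →
      ∃ u ∈ gridI N i, ∃ v ∈ gridI N i, (N : ℝ) * g u ≤ l ∧ (l : ℝ) + 1 ≤ N * g v)
    (hh : ∀ x, |(h x : ℝ) - g x| ≤ 1 / N) {x : unitI} (hx : x ∈ FixSet f k) :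
    ∃ u, x ∈ gridI Q u ∧ ∀ c < 2, ∃ y ∈ PerSet h k,
      y ∈ gridI Q u ∧ y ∈ gridI N ((4 * k + 1) * u + (1 + 2 * c * k)) := by
  have hNpos : 0 < N := by rw [hN]; positivity
  have hN0 : (0 : ℝ) < N := by exact_mod_cast hNpos
  have hfk : f^[k] x = x := hx
  choose u hu hu' using exists_mem_gridI hQ
  refine ⟨u x, hu' x, fun c hc ↦ ?_⟩
  have hck : c * k ≤ k := by nlinarith
  let ρ : ℕ → ℕ := fun t ↦ 1 + 2 * c * k + 2 * (t % k)
  have hρ : ∀ t, 1 ≤ ρ t ∧ ρ t + 1 < 4 * k + 1 := by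
    intro t
    have : t % k < k := Nat.mod_lt _ hk
    have h2 : 2 * c * k = 2 * (c * k) := mul_assoc _ _ _
    simp only [ρ, h2]; omega
  let j : ℕ → ℕ := fun t ↦ (4 * k + 1) * u (f^[t] x) + ρ t
  have hlt : ∀ t, ∀ σ < 4 * k + 1, (4 * k + 1) * u (f^[t] x) + σ < N := by
    intro t σ hσ
    have := hu (f^[t] x)
    rw [hN]; nlinarith
  have hj : ∀ t, j t < N := fun t ↦ hlt t _ (by have := hρ t; omega)
  -- any two points in consecutive blocks are admissible
  have hadm : ∀ t, ∀ w ∈ gridI Q (u (f^[t] x)), ∀ y ∈ gridI Q (u (f^[t + 1] x)),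
      |(f w : ℝ) - y| ≤ δ := by
    intro t w hw y hy
    have h1 := hosc _ _ (abs_sub_le_of_mem_gridI hQ hw (hu' (f^[t] x)))
    have h2 := abs_sub_le_of_mem_gridI hQ (hu' (f^[t + 1] x)) hy
    rw [← iterate_succ_apply' (⇑f) t x] at h1
    calc _ ≤ _ := abs_sub_le _ ((f^[t + 1] x : unitI) : ℝ) _
      _ ≤ δ := by linarith
  have hblock : ∀ t, ∀ σ < 4 * k + 1, gridI N ((4 * k + 1) * u (f^[t] x) + σ) ⊆
      gridI Q (u (f^[t] x)) := by
    intro t σ hσ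
    rw [hN]; exact gridI_mul_subset hσ
  have hcov : ∀ t, gridI N (j (t + 1)) ⊆ h '' gridI N (j t) := by
    intro t
    have hρt := hρ t
    have hρt' := hρ (t + 1)
    have hne : ∀ i (hi : i < N), gridPt hi.le ∈ gridI N i := by
      intro i hi
      rw [gridI_eq_Icc hi]; exact left_mem_Icc.2 (gridPt_lt_gridPt hi).le
    have hget : ∀ σ < 4 * k + 1, ∃ u' ∈ gridI N (j t), ∃ v' ∈ gridI N (j t),
        (N : ℝ) * g u' ≤ ((4 * k + 1) * u (f^[t + 1] x) + σ : ℕ) ∧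
        (((4 * k + 1) * u (f^[t + 1] x) + σ : ℕ) : ℝ) + 1 ≤ N * g v' := by
      intro σ hσ
      refine hfat _ (hj t) _ (hlt (t + 1) σ hσ) _ (hne _ (hj t)) _ (hne _ (hlt (t + 1) σ hσ)) ?_
      exact hadm t _ (hblock t (ρ t) (by omega) (hne _ (hj t))) _
        (hblock (t + 1) σ hσ (hne _ (hlt (t + 1) σ hσ)))
    obtain ⟨p, hp, -, -, hp1, -⟩ := hget (ρ (t + 1) - 1) (by omega)
    obtain ⟨-, -, r, hr, -, hr1⟩ := hget (ρ (t + 1) + 1) (by omega)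
    have hclose : ∀ z, |(N : ℝ) * h z - N * g z| ≤ 1 := by
      intro z
      rw [← mul_sub, abs_mul, abs_of_pos hN0]
      calc (N : ℝ) * |(h z : ℝ) - g z| ≤ N * (1 / N) := mul_le_mul_of_nonneg_left (hh z) hN0.le
        _ = 1 := by field_simp
    have hcp := abs_le.1 (hclose p)
    have hcr := abs_le.1 (hclose r)
    have hj' : (j (t + 1) : ℝ) = ((4 * k + 1) * u (f^[t + 1] x) + (ρ (t + 1) - 1) : ℕ) + 1 := by
      have : j (t + 1) = (4 * k + 1) * u (f^[t + 1] x) + (ρ (t + 1) - 1) + 1 := by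
        simp only [j]; omega
      exact_mod_cast this
    have hj'' : (j (t + 1) : ℝ) + 1 = ((4 * k + 1) * u (f^[t + 1] x) + (ρ (t + 1) + 1) : ℕ) := by
      have : j (t + 1) + 1 = (4 * k + 1) * u (f^[t + 1] x) + (ρ (t + 1) + 1) := by
        simp only [j]; omega
      exact_mod_cast this
    refine subset_image_of_forall_le (gridI_ordConnected _ _) hp hr ?_
    intro y hy
    obtain ⟨hy1, hy2⟩ := hy
    constructor
    · exact Subtype.coe_le_coe.1 (le_of_mul_le_mul_left (by linarith) hN0)
    · exact Subtype.coe_le_coe.1 (le_of_mul_le_mul_left (by linarith) hN0)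
  have hjk : j k = j 0 := by simp [j, ρ, hfk]
  obtain ⟨y, hyk, hyt⟩ := exists_periodic_of_covering h.continuous
    (fun t ↦ gridPt (hj t).le) (fun t ↦ gridPt (Nat.succ_le_of_lt (hj t)))
    (fun t ↦ (gridPt_lt_gridPt (hj t)).le)
    (fun t ↦ by rw [← gridI_eq_Icc (hj t), ← gridI_eq_Icc (hj (t + 1))]; exact hcov t)
    (k := k) (by simp only [hjk]) (by simp only [hjk])
  have hyt' : ∀ t ≤ k, h^[t] y ∈ gridI N (j t) := fun t ht ↦ by
    rw [gridI_eq_Icc (hj t)]; exact hyt t ht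
  have hy0 : y ∈ gridI N (j 0) := hyt' 0 (Nat.zero_le _)
  refine ⟨y, ⟨hyk, fun i hi hik hiy ↦ ?_⟩, ?_, ?_⟩
  · have h1 : y ∈ gridI N (j i) := by
      have := hyt' i hik.le
      rwa [hiy] at this
    have h2 := le_add_one_of_mem_gridI h1 hy0
    have h3 := le_add_one_of_mem_gridI hy0 h1
    have h4 := hρ 0
    have h5 := hρ i
    have h6 : ρ i = ρ 0 + 2 * i := by simp [ρ, Nat.mod_eq_of_lt hik]
    simp only [j] at h2 h3
    rcases lt_trichotomy (u (f^[i] x)) (u (f^[0] x)) with h | h | h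
    · have := Nat.mul_le_mul_left (4 * k + 1) (Nat.succ_le_of_lt h)
      rw [Nat.mul_succ] at this
      omega
    · rw [h] at h2 h3
      omega
    · have := Nat.mul_le_mul_left (4 * k + 1) (Nat.succ_le_of_lt h)
      rw [Nat.mul_succ] at this
      omega
  · exact hblock 0 (ρ 0) (by have := hρ 0; omega) hy0
  · simpa [j, ρ] using hy0

theorem continuous_iterate_eval_s17 (k : ℕ) :
    Continuous fun p : C(unitI, unitI) × unitI ↦ (p.1)^[k] p.2 := by
  induction k with
  | zero => exact continuous_snd
  | succ k ih =>
    have : (fun p : C(unitI, unitI) × unitI ↦ (p.1)^[k + 1] p.2) =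
        fun p ↦ p.1 ((p.1)^[k] p.2) := by
      ext1 p; exact iterate_succ_apply' _ _ _
    rw [this]
    exact continuous_fst.eval ih

/-- Upper semicontinuity of `Fix(·, k)`. -/
theorem eventually_fixSet_subset (f : C(unitI, unitI)) (k : ℕ) {U : Set unitI} (hU : IsOpen U)
    (hf : FixSet f k ⊆ U) : ∀ᶠ h : C(unitI, unitI) in nhds f, FixSet h k ⊆ U := by
  have hK : IsCompact Uᶜ := hU.isClosed_compl.isCompact
  have : ∀ᶠ h : C(unitI, unitI) in nhds f, ∀ x ∈ Uᶜ, h^[k] x ≠ x := by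
    refine hK.eventually_forall_of_forall_eventually fun x hx ↦ ?_
    have hop : IsOpen {p : C(unitI, unitI) × unitI | (p.1)^[k] p.2 ≠ p.2} :=
      isOpen_ne_fun (continuous_iterate_eval_s17 k) continuous_snd
    exact hop.mem_nhds fun h ↦ hx (hf h)
  filter_upwards [this] with h hh x hx
  by_contra hxU
  exact hh x hxU hx

/-- Sets with very economical finite covers have Hausdorff dimension zero. -/
theorem dimH_eq_zero_of_covers {S : Set unitI}
    (hS : ∀ n : ℕ, ∃ F : Finset unitI,
      S ⊆ ⋃ x ∈ F, ball x ((1 / ((n + 1) * (F.card + 1) : ℝ)) ^ (n + 1) / 2)) : dimH S = 0 := by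
  choose F hF using hS
  let η : ℕ → ℝ := fun n ↦ 1 / ((n + 1) * ((F n).card + 1) : ℝ)
  have hη0 : ∀ n, 0 < η n := fun n ↦ by positivity
  have hη1 : ∀ n, η n ≤ 1 / (n + 1) := by
    intro n
    refine one_div_le_one_div_of_le (by positivity) ?_
    have : (0 : ℝ) ≤ (n + 1) * (F n).card := by positivity
    linarith
  have hη2 : ∀ n, η n ≤ 1 := fun n ↦ (hη1 n).trans (by
    rw [div_le_one (by positivity)]; linarith [n.cast_nonneg (α := ℝ)])
  have hηc : ∀ n, (F n).card * η n ≤ 1 / (n + 1) := by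
    intro n
    simp only [η]
    rw [mul_one_div, div_le_div_iff₀ (by positivity) (by positivity)]
    nlinarith [n.cast_nonneg (α := ℝ), (F n).card.cast_nonneg (α := ℝ)]
  have hdiam : ∀ n (x : unitI), ediam (ball x (η n ^ (n + 1) / 2)) ≤
      ENNReal.ofReal (η n ^ (n + 1)) := by
    intro n x
    rw [← Metric.eball_ofReal]
    refine Metric.ediam_eball_le.trans ?_
    rw [show (2 : ENNReal) = ENNReal.ofReal 2 by simp, ← ENNReal.ofReal_mul (by norm_num)]
    apply ENNReal.ofReal_le_ofReal
    linarith
  have hlim : Filter.Tendsto (fun n : ℕ ↦ ENNReal.ofReal (1 / ((n : ℝ) + 1))) Filter.atTop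
      (nhds 0) := by
    rw [← ENNReal.ofReal_zero]
    exact ENNReal.tendsto_ofReal tendsto_one_div_add_atTop_nhds_zero_nat
  have hmeas : ∀ d : NNReal, 0 < d → MeasureTheory.Measure.hausdorffMeasure (d : ℝ) S = 0 := by
    intro d hd
    have h1 := MeasureTheory.Measure.hausdorffMeasure_le_liminf_sum (ι := fun n ↦ F n) (d : ℝ) S
      (fun n : ℕ ↦ ENNReal.ofReal (1 / ((n : ℝ) + 1))) hlim
      (fun n i ↦ ball (i : unitI) (η n ^ (n + 1) / 2))
      (Filter.Eventually.of_forall fun n i ↦ (hdiam n i).trans (ENNReal.ofReal_le_ofReal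
        ((pow_le_of_le_one (hη0 n).le (hη2 n) (Nat.succ_ne_zero n)).trans (hη1 n))))
      (Filter.Eventually.of_forall fun n x hx ↦ by
        obtain ⟨y, hy, hxy⟩ := mem_iUnion₂.1 (hF n hx)
        exact mem_iUnion.2 ⟨⟨y, hy⟩, hxy⟩)
    refine le_antisymm (h1.trans ?_) zero_le
    rw [← hlim.liminf_eq]
    refine Filter.liminf_le_liminf ?_
    obtain ⟨n₀, hn₀⟩ := exists_nat_gt (1 / (d : ℝ))
    filter_upwards [Filter.eventually_ge_atTop n₀] with n hn
    have hd' : (0 : ℝ) < d := hd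
    have hnd : 1 ≤ ((n + 1 : ℕ) : ℝ) * d := by
      have h2 : (n₀ : ℝ) ≤ n := by exact_mod_cast hn
      rw [div_lt_iff₀ hd'] at hn₀
      push_cast
      nlinarith
    have hterm : ∀ x : unitI, ediam (ball x (η n ^ (n + 1) / 2)) ^ (d : ℝ) ≤
        ENNReal.ofReal (η n) := by
      intro x
      refine (ENNReal.rpow_le_rpow (hdiam n x) hd'.le).trans ?_
      rw [ENNReal.ofReal_rpow_of_nonneg (pow_nonneg (hη0 n).le _) hd'.le, ← Real.rpow_natCast,
        ← Real.rpow_mul (hη0 n).le]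
      apply ENNReal.ofReal_le_ofReal
      calc η n ^ (((n + 1 : ℕ) : ℝ) * d) ≤ η n ^ (1 : ℝ) :=
            Real.rpow_le_rpow_of_exponent_ge (hη0 n) (hη2 n) hnd
        _ = η n := Real.rpow_one _
    refine (Finset.sum_le_sum fun (i : F n) _ ↦ hterm i).trans ?_
    rw [Finset.sum_const, Finset.card_univ, Fintype.card_coe, nsmul_eq_mul,
      ← ENNReal.ofReal_natCast, ← ENNReal.ofReal_mul (by positivity)]
    exact ENNReal.ofReal_le_ofReal (hηc n)
  by_contra hne
  obtain ⟨d, hd0, hd⟩ := ENNReal.lt_iff_exists_nnreal_btwn.1 (pos_iff_ne_zero.2 hne)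
  have h1 := hmeas d (by exact_mod_cast hd0)
  rw [hausdorffMeasure_of_lt_dimH hd] at h1
  exact ENNReal.top_ne_zero h1

theorem isTotallyDisconnected_of_dimH_eq_zero {S : Set unitI} (hS : dimH S = 0) :
    IsTotallyDisconnected S := by
  intro t htS ht a ha b hb
  by_contra hab
  have hsub : uIcc a b ⊆ S := (ht.ordConnected.uIcc_subset ha hb).trans htS
  have h1 : dimH ((↑) '' uIcc a b : Set ℝ) = 0 := by
    rw [isometry_subtype_coe.dimH_image]
    exact le_antisymm ((dimH_mono hsub).trans hS.le) zero_le
  have h2 : segment ℝ (a : ℝ) b ⊆ (↑) '' uIcc a b := by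
    rw [segment_eq_uIcc]
    exact intermediate_value_uIcc continuous_subtype_val.continuousOn
  have h3 := dimH_mono h2
  rw [Real.dimH_segment (fun h ↦ hab (Subtype.ext h)), h1] at h3
  simp at h3

/-- The approximate form, at scale `1 / (n + 1)`, of the properties of `Fix(h, k)`: every point of
`Fix(h, k)` is close to another point of `Per(h, k)`, and `Fix(h, k)` has an economical cover. -/
def IsGoodAt (k n : ℕ) (h : C(unitI, unitI)) : Prop :=
  (∀ z ∈ FixSet h k, ∃ y ∈ PerSet h k, y ≠ z ∧ dist y z < 1 / ((n : ℝ) + 1)) ∧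
    ∃ F : Finset unitI,
      FixSet h k ⊆ ⋃ x ∈ F, ball x ((1 / ((n + 1) * (F.card + 1) : ℝ)) ^ (n + 1) / 2)

theorem exists_eventually_isGoodAt {f : C(unitI, unitI)} (hf : Dense (periodicPts f)) {k : ℕ}
    (hk : 1 ≤ k) (n : ℕ) {W : Set C(unitI, unitI)} (hW : W ∈ nhds f) :
    ∃ g ∈ W, g ∈ CP ∧ ∀ᶠ h in nhds g, IsGoodAt k n h := by
  set ε : ℝ := 1 / ((n : ℝ) + 1) with hε
  have hε0 : 0 < ε := by positivity
  have hfix := eventually_fixSet_subset f k (isOpen_thickening (δ := ε / 2) (E := FixSet f k))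
    (self_subset_thickening (by positivity) _)
  obtain ⟨r, hr, hball⟩ := Metric.mem_nhds_iff.1 (Filter.inter_mem hW hfix)
  obtain ⟨q₀, hq₀⟩ := exists_nat_gt (6 / r)
  have hq₀' : (0 : ℝ) < q₀ := (by positivity : 0 < 6 / r).trans hq₀
  obtain ⟨q, hq, hqr⟩ : ∃ q : ℕ, 1 ≤ q ∧ 6 / (q : ℝ) < r := by
    refine ⟨q₀, by exact_mod_cast hq₀', ?_⟩
    rw [div_lt_iff₀ hr] at hq₀
    rw [div_lt_iff₀ hq₀']; linarith
  have hq0 : (0 : ℝ) < q := by exact_mod_cast hq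
  obtain ⟨η, hη, hfη⟩ := Metric.uniformContinuous_iff.1
    (CompactSpace.uniformContinuous_of_continuous f.continuous) (1 / (q : ℝ) / 2) (by positivity)
  obtain ⟨s₀, hs₀⟩ := exists_nat_gt (max (1 / η) (1 / (ε / 2)))
  obtain ⟨s, hs2, hss₀⟩ : ∃ s : ℕ, 2 ≤ s ∧ s₀ ≤ s := ⟨max 2 s₀, le_max_left _ _, le_max_right _ _⟩
  have hs2' : (2 : ℝ) ≤ s := by exact_mod_cast hs2
  have hs1 : max (1 / η) (1 / (ε / 2)) < s := hs₀.trans_le (by exact_mod_cast hss₀)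
  let Q := q * s
  let N := Q * (4 * k + 1)
  have hQ : 0 < Q := by positivity
  have hQ0 : (0 : ℝ) < Q := by exact_mod_cast hQ
  have hNQ : Q ≤ N := Nat.le_mul_of_pos_right _ (by omega)
  have hNQ' : (Q : ℝ) ≤ N := by exact_mod_cast hNQ
  have hQqs : (Q : ℝ) = q * s := by simp [Q]
  have hsQ : (s : ℝ) ≤ Q := by
    rw [hQqs]
    exact le_mul_of_one_le_left (by positivity) (by exact_mod_cast hq)
  have hQη : 1 / (Q : ℝ) < η := by
    rw [one_div_lt hQ0 hη]
    exact (le_max_left _ _).trans_lt (hs1.trans_le hsQ)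
  have hQε : 1 / (Q : ℝ) < ε / 2 := by
    rw [one_div_lt hQ0 (by positivity)]
    exact (le_max_right _ _).trans_lt (hs1.trans_le hsQ)
  have hQδ : 1 / (Q : ℝ) ≤ 1 / (q : ℝ) / 2 := by
    rw [div_div, hQqs]
    exact one_div_le_one_div_of_le (by positivity) (mul_le_mul_of_nonneg_left hs2' hq0.le)
  have hosc : ∀ x y : unitI, |(x : ℝ) - y| ≤ 1 / Q → |(f x : ℝ) - f y| ≤ 1 / (q : ℝ) / 2 :=
    fun x y hxy ↦ (hfη (a := x) (b := y) (hxy.trans_lt hQη)).le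
  have hosc' : ∀ x y : unitI, |(x : ℝ) - y| ≤ 1 / N → |(f x : ℝ) - f y| ≤ 1 / (q : ℝ) := by
    intro x y hxy
    refine (hosc x y (hxy.trans (one_div_le_one_div_of_le hQ0 hNQ'))).trans ?_
    have : (0 : ℝ) < 1 / q := by positivity
    linarith
  have hN2 : 2 ≤ N := hs2.trans ((by exact_mod_cast hsQ : s ≤ Q).trans hNQ)
  obtain ⟨g, hgf, hexp, hcov, hfat⟩ := exists_fat_markov f (q := q) (s := s * (4 * k + 1)) (N := N)
    hq (by nlinarith) (mul_assoc _ _ _) hN2 hosc'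
  have hN0 : (0 : ℝ) < N := hQ0.trans_le hNQ'
  have hgr : g ∈ ball f r :=
    ((ContinuousMap.dist_le (by positivity)).2 fun x ↦ hgf x).trans_lt hqr
  have hper : Dense (periodicPts g) := by
    refine dense_periodicPts_of_expanding (by omega) (by omega) hexp hcov
      (gridI_reachable hf (δ := 1 / (q : ℝ)) (by positivity) ?_)
    intro i hi l hl w hw y hy hwy
    obtain ⟨u, hu, v, hv, h1, h2⟩ := hfat i hi l hl w hw y hy hwy
    refine subset_image_of_forall_le (gridI_ordConnected _ _) hu hv fun z hz ↦ ⟨?_, ?_⟩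
    · exact Subtype.coe_le_coe.1 (le_of_mul_le_mul_left (h1.trans hz.1) hN0)
    · exact Subtype.coe_le_coe.1 (le_of_mul_le_mul_left (hz.2.trans h2) hN0)
  have hsurj : Surjective g := by
    have hsub : periodicPts g ⊆ range g := by
      rintro x ⟨m, hm, hx⟩
      refine ⟨g^[m - 1] x, ?_⟩
      rw [← iterate_succ_apply' (⇑g) (m - 1) x, Nat.succ_eq_add_one, Nat.sub_add_cancel hm]
      exact hx
    rw [← range_eq_univ, ← (isCompact_range g.continuous).isClosed.closure_eq]
    exact (hper.mono hsub).closure_eq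
  have hfin : (FixSet g k).Finite := finite_fixed_of_expanding (by omega) hexp hk
  refine ⟨g, (hball hgr).1, ⟨hsurj, hper⟩, ?_⟩
  have hcover := eventually_fixSet_subset g k
    (U := ⋃ x ∈ hfin.toFinset,
      ball x ((1 / ((n + 1) * (hfin.toFinset.card + 1) : ℝ)) ^ (n + 1) / 2))
    (isOpen_biUnion fun _ _ ↦ isOpen_ball)
    (fun x hx ↦ mem_iUnion₂.2 ⟨x, hfin.mem_toFinset.2 hx, mem_ball_self (by positivity)⟩)
  filter_upwards [hcover, isOpen_ball.mem_nhds hgr,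
    ball_mem_nhds g (by positivity : 0 < 1 / (N : ℝ))] with h hh1 hh2 hh3
  refine ⟨fun z hz ↦ ?_, _, hh1⟩
  obtain ⟨x, hx, hzx⟩ := mem_thickening_iff.1 ((hball hh2).2 hz)
  have hclose : ∀ x, |(h x : ℝ) - g x| ≤ 1 / N := fun x ↦
    (ContinuousMap.dist_apply_le_dist (f := h) (g := g) x).trans (le_of_lt hh3)
  obtain ⟨u, hxu, hu⟩ := exists_mem_perSet_near hk hQ rfl hQδ hosc hfat hclose hx
  have hdist : ∀ y ∈ gridI Q u, dist y z < ε := by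
    intro y hy
    have h1 : dist y x ≤ 1 / Q := abs_sub_le_of_mem_gridI hQ hy hxu
    have h2 := dist_triangle y x z
    rw [dist_comm x z] at h2
    linarith
  obtain ⟨y₀, hy₀, hy₀u, hy₀N⟩ := hu 0 (by norm_num)
  obtain ⟨y₁, hy₁, hy₁u, hy₁N⟩ := hu 1 (by norm_num)
  by_cases hne : y₀ = z
  · refine ⟨y₁, hy₁, ?_, hdist _ hy₁u⟩
    rintro rfl
    rw [hne] at hy₀N
    have := le_add_one_of_mem_gridI hy₁N hy₀N
    omega
  · exact ⟨y₀, hy₀, hne, hdist _ hy₀u⟩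

theorem perSet_subset_fixSet (f : unitI → unitI) (k : ℕ) : PerSet f k ⊆ FixSet f k :=
  fun _ hx ↦ hx.1

theorem fixSet_nonempty (f : C(unitI, unitI)) (k : ℕ) : (FixSet f k).Nonempty := by
  obtain ⟨x, -, hx⟩ := exists_mem_Icc_isFixedPt (f := f) (a := 0) (b := 1)
    f.continuous.continuousOn zero_le_one (f 0).2.1 (f 1).2.2
  exact ⟨x, hx.iterate k⟩

theorem isClosed_fixSet (f : C(unitI, unitI)) (k : ℕ) : IsClosed (FixSet f k) :=
  isClosed_eq (f.continuous.iterate k) continuous_id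

theorem exists_isOpen_perSet_eq (f : C(unitI, unitI)) (k : ℕ) :
    ∃ U : Set unitI, IsOpen U ∧ PerSet f k = U ∩ FixSet f k := by
  refine ⟨⋂ i ∈ Finset.Ico 1 k, {x | f^[i] x ≠ x}, ?_, ?_⟩
  · exact isOpen_biInter_finset fun i _ ↦ isOpen_ne_fun (f.continuous.iterate i) continuous_id
  · ext x
    simp only [PerSet, FixSet, mem_inter_iff, mem_iInter, Finset.mem_Ico, mem_ofPred_eq]
    tauto

theorem dimH_fixSet_eq_zero {f : C(unitI, unitI)} {k : ℕ} (hf : ∀ n, IsGoodAt k n f) :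
    dimH (FixSet f k) = 0 :=
  dimH_eq_zero_of_covers fun n ↦ (hf n).2

theorem exists_perSet_near {f : C(unitI, unitI)} {k : ℕ} (hf : ∀ n, IsGoodAt k n f) {z : unitI}
    (hz : z ∈ FixSet f k) {ε : ℝ} (hε : 0 < ε) : ∃ y ∈ PerSet f k, y ≠ z ∧ dist y z < ε := by
  obtain ⟨n, hn⟩ := exists_nat_one_div_lt hε
  obtain ⟨y, hy, hne, hd⟩ := (hf n).1 z hz
  exact ⟨y, hy, hne, hd.trans hn⟩

theorem perfect_fixSet {f : C(unitI, unitI)} {k : ℕ} (hf : ∀ n, IsGoodAt k n f) :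
    Perfect (FixSet f k) := by
  refine ⟨isClosed_fixSet f k, fun z hz ↦ accPt_iff_nhds.2 fun U hU ↦ ?_⟩
  obtain ⟨ε, hε, hball⟩ := Metric.mem_nhds_iff.1 hU
  obtain ⟨y, hy, hne, hd⟩ := exists_perSet_near hf hz hε
  exact ⟨y, ⟨hball hd, hy.1⟩, hne⟩

theorem dense_interior_isGoodAt {k : ℕ} (hk : 1 ≤ k) (n : ℕ) :
    Dense (interior {f : (closure CP : Set C(unitI, unitI)) | IsGoodAt k n f}) := by
  rw [dense_iff_inter_open]
  rintro V hV ⟨f, hf⟩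
  obtain ⟨W, hW, rfl⟩ := isOpen_induced_iff.1 hV
  obtain ⟨f', hf'W, hf'⟩ := mem_closure_iff.1 f.2 W hW hf
  obtain ⟨g, hgW, hg, hgood⟩ := exists_eventually_isGoodAt hf'.2 hk n (hW.mem_nhds hf'W)
  refine ⟨⟨g, subset_closure hg⟩, hgW, mem_interior_iff_mem_nhds.2 ?_⟩
  exact continuous_subtype_val.continuousAt.eventually hgood

/-- There is a residual subset `R` of `cl(CP)` such that for every `f ∈ R` and every
`k ≥ 1`: `Fix(f,k)` is a Cantor set; `Per(f,k)` is a relatively open dense subset of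
`Fix(f,k)`; and `Fix(f,k)` (hence also `Per(f)`) has Hausdorff dimension zero. -/
theorem generic_periodic_point_structure :
    ∃ R : Set (closure CP : Set C(unitI, unitI)), IsGδ R ∧ Dense R ∧
      ∀ f ∈ R, ∀ k : ℕ, 1 ≤ k →
        ((FixSet ⇑(f : C(unitI, unitI)) k).Nonempty ∧
          IsCompact (FixSet ⇑(f : C(unitI, unitI)) k) ∧
          Perfect (FixSet ⇑(f : C(unitI, unitI)) k) ∧
          IsTotallyDisconnected (FixSet ⇑(f : C(unitI, unitI)) k)) ∧
        ((∃ U : Set unitI, IsOpen U ∧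
            PerSet ⇑(f : C(unitI, unitI)) k = U ∩ FixSet ⇑(f : C(unitI, unitI)) k) ∧
          FixSet ⇑(f : C(unitI, unitI)) k ⊆ closure (PerSet ⇑(f : C(unitI, unitI)) k)) ∧
        dimH (FixSet ⇑(f : C(unitI, unitI)) k) = 0 ∧
        dimH (PerAll ⇑(f : C(unitI, unitI))) = 0 := by
  let G : ℕ × ℕ → Set (closure CP : Set C(unitI, unitI)) := fun p ↦
    interior {f | IsGoodAt (p.1 + 1) p.2 f}
  have : CompleteSpace (closure CP : Set C(unitI, unitI)) :=
    isClosed_closure.completeSpace_coe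
  refine ⟨⋂ p, G p, IsGδ.iInter_of_isOpen fun p ↦ isOpen_interior,
    dense_iInter_of_isOpen (fun p ↦ isOpen_interior)
      (fun p ↦ dense_interior_isGoodAt (by omega) p.2), ?_⟩
  intro f hf
  have hgood : ∀ k, 1 ≤ k → ∀ n, IsGoodAt k n (f : C(unitI, unitI)) := by
    intro k hk n
    have h : f ∈ {f : (closure CP : Set C(unitI, unitI)) | IsGoodAt (k - 1 + 1) n f} :=
      interior_subset (mem_iInter.1 hf (k - 1, n))
    rw [Nat.sub_add_cancel hk] at h
    exact h
  intro k hk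
  have hdim := dimH_fixSet_eq_zero (hgood k hk)
  refine ⟨⟨fixSet_nonempty _ k, (isClosed_fixSet _ k).isCompact, perfect_fixSet (hgood k hk),
    isTotallyDisconnected_of_dimH_eq_zero hdim⟩, ⟨exists_isOpen_perSet_eq _ k, ?_⟩, hdim, ?_⟩
  · intro z hz
    refine Metric.mem_closure_iff.2 fun ε hε ↦ ?_
    obtain ⟨y, hy, -, hd⟩ := exists_perSet_near (hgood k hk) hz hε
    exact ⟨y, hy, by rwa [dist_comm]⟩
  · rw [PerAll, dimH_bUnion (to_countable _)]
    simp only [ENNReal.iSup_eq_zero]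
    intro j hj
    exact le_antisymm ((dimH_mono (perSet_subset_fixSet _ j)).trans
      (dimH_fixSet_eq_zero (hgood j hj)).le) zero_le
end
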